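/- arXiv:1603.07471 — 3 statements merged into one kernel-verified Lean document; each statement's English description precedes it below -/
import Mathlib

section
/- Let p be an odd prime, q = p^h, and n ≥ 3. A bijection γ : 𝔽_q^n → 𝔽_q^n is an integral automorphism of AG(n,q) if and only if there exist a ∈ 𝔽_q^×, an integer i with 0 ≤ i ≤ h−1, a matrix A ∈ GL(n,q) with A·Aᵀ = I, and b ∈ 𝔽_q^n such that γ(x) = a·σ^i(x)·A + b for all x ∈ 𝔽_q^n, where σ is the coordinatewise Frobenius map (x_1,…,x_n) ↦ (x_1^p,…,x_n^p). -/
section Counting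

variable {F : Type*} [Field F] [Fintype F] [DecidableEq F]

theorem sum_comp_sq (hF : ringChar F ≠ 2) (φ : F → ℤ) :
    ∑ y, φ (y ^ 2) = ∑ d, (quadraticChar F d + 1) * φ d := by
  rw [← Finset.sum_fiberwise Finset.univ (fun y : F => y ^ 2)]
  refine Finset.sum_congr rfl fun d _ => ?_
  rw [Finset.sum_congr rfl (g := fun _ => φ d) fun y hy => by rw [(Finset.mem_filter.1 hy).2],
    Finset.sum_const, nsmul_eq_mul, ← quadraticChar_card_sqrts hF d]
  congr 3
  ext; simp

theorem sum_comp_mul (φ : F → ℤ) :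
    ∑ u, ∑ v, φ (u * v) = (Fintype.card F - 1) * ∑ c, φ c + Fintype.card F * φ 0 := by
  rw [← Finset.add_sum_erase _ _ (Finset.mem_univ (0 : F)),
    Finset.sum_congr rfl (g := fun _ => ∑ c, φ c) fun u hu =>
      Fintype.sum_equiv (Equiv.mulLeft₀ u (Finset.ne_of_mem_erase hu)) _ _ fun _ => rfl]
  rw [Finset.sum_const, Finset.card_erase_of_mem (Finset.mem_univ _), Finset.card_univ]
  simp [Nat.cast_sub Fintype.card_pos]
  ring

theorem sum_comp_sq_sub_sq (hF : ringChar F ≠ 2) (φ : F → ℤ) :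
    ∑ x, ∑ y, φ (x ^ 2 - y ^ 2) =
      (Fintype.card F - 1) * ∑ c, φ c + Fintype.card F * φ 0 := by
  have h2 : (2 : F) ≠ 0 := Ring.two_ne_zero hF
  rw [← sum_comp_mul, ← Fintype.sum_prod_type', ← Fintype.sum_prod_type']
  let e : F × F ≃ F × F :=
    { toFun := fun z => (z.1 - z.2, z.1 + z.2)
      invFun := fun z => ((z.1 + z.2) / 2, (z.2 - z.1) / 2)
      left_inv := fun z => by ext <;> simp <;> field_simp <;> ring
      right_inv := fun z => by ext <;> simp <;> field_simp <;> ring }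
  refine Fintype.sum_equiv e _ _ fun z => ?_
  simp only [e, Equiv.coe_fn_mk]
  congr 1; ring

theorem sum_quadraticChar_sq_sub (hF : ringChar F ≠ 2) (d : F) :
    ∑ x, quadraticChar F (x ^ 2 - d) = -1 + Fintype.card F * (if d = 0 then 1 else 0) := by
  have h := sum_comp_sq_sub_sq hF (fun c => if c = d then 1 else 0)
  have h1 : ∀ x : F, ∑ y, (if x ^ 2 - y ^ 2 = d then (1 : ℤ) else 0) =
      quadraticChar F (x ^ 2 - d) + 1 := fun x => by
    rw [sum_comp_sq hF (fun z => if x ^ 2 - z = d then (1 : ℤ) else 0)]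
    rw [Finset.sum_eq_single (x ^ 2 - d)] <;> simp
    intro b hb hb'
    exact absurd (by rw [← hb']; ring) hb
  simp only [h1, Finset.sum_add_distrib, eq_comm (a := (0 : F))] at h
  simp at h
  simp
  linarith

theorem sum_comp_binary (hF : ringChar F ≠ 2) {α β : F} (hα : α ≠ 0) (hβ : β ≠ 0) (φ : F → ℤ) :
    ∑ x, ∑ y, φ (α * x ^ 2 + β * y ^ 2) =
      (Fintype.card F - quadraticChar F (-(α * β))) * ∑ c, φ c +
        quadraticChar F (-(α * β)) * Fintype.card F * φ 0 := by
  have h1 : ∀ x : F, ∑ y, φ (α * x ^ 2 + β * y ^ 2) =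
      ∑ c, (quadraticChar F (-(α * β)) * quadraticChar F (x ^ 2 - c / α) + 1) * φ c := fun x => by
    rw [sum_comp_sq hF (fun z => φ (α * x ^ 2 + β * z))]
    refine Fintype.sum_equiv ((Equiv.mulLeft₀ β hβ).trans (Equiv.addLeft (α * x ^ 2))) _ _
      fun d => ?_
    change _ = (_ * quadraticChar F (x ^ 2 - (α * x ^ 2 + β * d) / α) + 1) * φ (α * x ^ 2 + β * d)
    rw [← map_mul]
    have : -(α * β) * (x ^ 2 - (α * x ^ 2 + β * d) / α) = β ^ 2 * d := by field_simp; ring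
    rw [this, map_mul, quadraticChar_sq_one' hβ, one_mul]
  generalize quadraticChar F (-(α * β)) = η at h1 ⊢
  have h2 : ∀ c : F, ∑ x, (η * quadraticChar F (x ^ 2 - c / α) + 1) * φ c =
      (Fintype.card F - η) * φ c + η * Fintype.card F * (if c = 0 then φ c else 0) := fun c => by
    rw [← Finset.sum_mul, Finset.sum_add_distrib, ← Finset.mul_sum,
      sum_quadraticChar_sq_sub hF, Finset.sum_const, Finset.card_univ, nsmul_eq_mul]
    by_cases hc : c = 0
    · simp only [hc, zero_div, if_true]; ring
    · simp only [hc, div_eq_zero_iff, hα, or_self, if_false]; ring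
  simp only [h1]
  rw [Finset.sum_comm]
  simp only [h2, Finset.sum_add_distrib, ← Finset.mul_sum]
  simp

omit [DecidableEq F] in
/-- Splitting off the first two variables of a diagonal quadratic form. -/
theorem sum_comp_diagonal_succ_succ (k : ℕ) (a : Fin (k + 2) → F) (φ : F → ℤ) :
    ∑ x : Fin (k + 2) → F, φ (∑ i, a i * x i ^ 2) =
      ∑ x, ∑ y, ∑ w : Fin k → F,
        φ ((a 0 * x ^ 2 + a 1 * y ^ 2) + ∑ i, a i.succ.succ * w i ^ 2) := by
  rw [← (Fin.consEquiv fun _ : Fin (k + 2) => F).sum_comp, Fintype.sum_prod_type]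
  refine Finset.sum_congr rfl fun x _ => ?_
  rw [← (Fin.consEquiv fun _ : Fin (k + 1) => F).sum_comp, Fintype.sum_prod_type]
  refine Finset.sum_congr rfl fun y _ => Finset.sum_congr rfl fun w _ => ?_
  rw [Fin.sum_univ_succ, Fin.sum_univ_succ]
  exact congrArg φ (add_assoc _ _ _).symm

/-- Summing a function of a nondegenerate diagonal quadratic form in `2 * m` variables. -/
theorem exists_sum_comp_diagonal (hF : ringChar F ≠ 2) (m : ℕ) (a : Fin (2 * m) → F)
    (ha : ∀ i, a i ≠ 0) :
    ∃ e : ℤ, (e = 1 ∨ e = -1) ∧ ∀ φ : F → ℤ,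
      Fintype.card F * ∑ x : Fin (2 * m) → F, φ (∑ i, a i * x i ^ 2) =
        ((Fintype.card F : ℤ) ^ (2 * m) - e * (Fintype.card F : ℤ) ^ m) * ∑ c, φ c +
          e * (Fintype.card F : ℤ) ^ (m + 1) * φ 0 := by
  induction m with
  | zero => exact ⟨1, Or.inl rfl, fun φ => by simp [Finset.univ_unique]⟩
  | succ m ih =>
    obtain ⟨e, he, h⟩ := ih (fun i => a i.succ.succ) fun i => ha _
    have hη := quadraticChar_dichotomy (F := F) (a := -(a 0 * a 1)) (by simp [ha])
    refine ⟨e * quadraticChar F (-(a 0 * a 1)), ?_, fun φ => ?_⟩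
    · rcases he with rfl | rfl <;> rcases hη with hη | hη <;> simp [hη]
    have hs : ∀ t : F, ∑ c, φ (t + c) = ∑ c, φ c := fun t =>
      Equiv.sum_comp (Equiv.addLeft t) φ
    have key : ∀ t : F, Fintype.card F * ∑ w : Fin (2 * m) → F,
        φ (t + ∑ i : Fin (2 * m), a i.succ.succ * w i ^ 2) =
        ((Fintype.card F : ℤ) ^ (2 * m) - e * (Fintype.card F : ℤ) ^ m) * ∑ c, φ c +
          e * (Fintype.card F : ℤ) ^ (m + 1) * φ t := fun t => by
      rw [h (fun c => φ (t + c)), hs, add_zero]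
    have hsplit := sum_comp_diagonal_succ_succ (2 * m) a φ
    change (Fintype.card F : ℤ) * ∑ x : Fin (2 * m + 2) → F,
      φ (∑ i : Fin (2 * m + 2), a i * x i ^ 2) = _
    rw [hsplit]
    simp only [Finset.mul_sum] at key ⊢
    simp only [key]
    simp only [Finset.sum_add_distrib, ← Finset.mul_sum]
    rw [sum_comp_binary hF (ha 0) (ha 1)]
    generalize quadraticChar F (-(a 0 * a 1)) = η
    simp only [Finset.sum_const, Finset.card_univ, nsmul_eq_mul]
    ring

end Counting

section SquareSign

variable {F : Type*} [Field F] [Fintype F]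

open Classical in
/-- The function equal to `1` on squares and to `-1` on nonsquares. -/
noncomputable def squareSign (t : F) : ℤ := if IsSquare t then 1 else -1

theorem squareSign_congr {s t : F} (h : IsSquare s ↔ IsSquare t) :
    squareSign s = squareSign t := by
  unfold squareSign; split_ifs <;> tauto

theorem squareSign_mul_self (t : F) : squareSign t * squareSign t = 1 := by
  unfold squareSign; split_ifs <;> rfl

theorem sum_squareSign (hF : ringChar F ≠ 2) : ∑ t : F, squareSign t = 1 := by
  classical
  have h : ∀ t : F, squareSign t = quadraticChar F t + if t = 0 then 1 else 0 := fun t => by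
    by_cases ht : t = 0
    · simp [squareSign, ht]
    · by_cases hs : IsSquare t
      · simp [squareSign, ht, hs, (quadraticChar_one_iff_isSquare ht).2 hs, -quadraticChar_apply]
      · simp [squareSign, ht, hs, quadraticChar_neg_one_iff_not_isSquare.2 hs, -quadraticChar_apply]
  simp only [h, Finset.sum_add_distrib, quadraticChar_sum_zero hF]
  simp

theorem sum_comp_affine {u : F} (hu : u ≠ 0) (c : F) (φ : F → ℤ) :
    ∑ t, φ (u * t + c) = ∑ t, φ t :=
  Fintype.sum_equiv ((Equiv.mulLeft₀ u hu).trans (Equiv.addRight c)) _ _ fun _ => rfl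

theorem sum_comp_add (c : F) (φ : F → ℤ) : ∑ t, φ (t + c) = ∑ t, φ t :=
  Equiv.sum_comp (Equiv.addRight c) φ

/-- The correlation `∑ a, squareSign a * squareSign (a - b)`. -/
noncomputable def squareCorr (b : F) : ℤ := ∑ a, squareSign a * squareSign (a - b)

theorem squareCorr_zero : squareCorr (0 : F) = Fintype.card F := by
  simp [squareCorr, squareSign_mul_self]

theorem sum_squareCorr (hF : ringChar F ≠ 2) : ∑ b : F, squareCorr b = 1 := by
  simp only [squareCorr]
  rw [Finset.sum_comm]
  simp only [← Finset.mul_sum]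
  have : ∀ a : F, ∑ b, squareSign (a - b) = 1 := fun a => by
    rw [← sum_squareSign hF]
    exact Equiv.sum_comp (Equiv.subLeft a) _
  simp [this, sum_squareSign hF]

end SquareSign

section Averaging

variable {F : Type*} [Field F] [Fintype F] {n : ℕ}

theorem card_mul_sum_eq_sum_sum (u : Fin n → F) (Φ : (Fin n → F) → ℤ) :
    Fintype.card F * ∑ z, Φ z = ∑ z, ∑ t : F, Φ (z + t • u) := by
  rw [Finset.sum_comm]
  have : ∀ t : F, ∑ z, Φ (z + t • u) = ∑ z, Φ z := fun t => Equiv.sum_comp (Equiv.addRight (t • u)) Φ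
  simp [this]

omit [Fintype F] in
theorem exists_dotProduct_eq_one {v : Fin n → F} (hv : v ≠ 0) : ∃ u : Fin n → F, u ⬝ᵥ v = 1 := by
  obtain ⟨i, hi⟩ := Function.ne_iff.1 hv
  exact ⟨Pi.single i (v i)⁻¹, by rw [single_dotProduct]; exact inv_mul_cancel₀ hi⟩

omit [Fintype F] in
theorem exists_eq_smul_of_dotProduct {v w : Fin n → F} (hv : v ≠ 0)
    (h : ∀ u : Fin n → F, u ⬝ᵥ v = 0 → u ⬝ᵥ w = 0) : ∃ c : F, w = c • v := by
  obtain ⟨u, hu⟩ := exists_dotProduct_eq_one hv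
  refine ⟨u ⬝ᵥ w, ?_⟩
  ext i
  have := h (Pi.single i 1 - (v i) • u) (by
    rw [sub_dotProduct, smul_dotProduct, hu, single_dotProduct]; simp)
  rw [sub_dotProduct, smul_dotProduct, single_dotProduct, one_mul, sub_eq_zero] at this
  rw [this, Pi.smul_apply, smul_eq_mul, smul_eq_mul, mul_comm]

theorem card_mul_sum_comp_dotProduct {v : Fin n → F} (hv : v ≠ 0) (φ : F → ℤ) :
    Fintype.card F * ∑ z : Fin n → F, φ (z ⬝ᵥ v) = (Fintype.card F : ℤ) ^ n * ∑ c, φ c := by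
  obtain ⟨u, hu⟩ := exists_dotProduct_eq_one hv
  rw [card_mul_sum_eq_sum_sum u]
  simp only [add_dotProduct, smul_dotProduct, hu, smul_eq_mul, mul_one]
  simp only [add_comm _ (_ : F), sum_comp_add]
  simp

theorem card_sq_dvd_sum_comp_dotProduct {v w : Fin n → F} (hv : v ≠ 0) (φ : F → F → ℤ) :
    ∃ k : ℤ, (Fintype.card F : ℤ) ^ 2 * ∑ z : Fin n → F, φ (z ⬝ᵥ v) (z ⬝ᵥ w) =
      (Fintype.card F : ℤ) ^ n * k := by
  by_cases h : ∀ u : Fin n → F, u ⬝ᵥ v = 0 → u ⬝ᵥ w = 0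
  · obtain ⟨c, rfl⟩ := exists_eq_smul_of_dotProduct hv h
    have := card_mul_sum_comp_dotProduct hv (fun b => φ b (c * b))
    refine ⟨Fintype.card F * ∑ b, φ b (c * b), ?_⟩
    simp only [dotProduct_smul, smul_eq_mul]
    rw [pow_two, mul_assoc, this]; ring
  · push Not at h
    obtain ⟨u, hu, hu'⟩ := h
    obtain ⟨u', hu1⟩ := exists_dotProduct_eq_one hv
    refine ⟨∑ b, ∑ c, φ b c, ?_⟩
    rw [pow_two, mul_assoc, card_mul_sum_eq_sum_sum u, card_mul_sum_eq_sum_sum u']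
    have h1 : ∀ (z : Fin n → F), ∑ t : F, ∑ s : F,
        φ ((z + t • u' + s • u) ⬝ᵥ v) ((z + t • u' + s • u) ⬝ᵥ w) = ∑ b, ∑ c, φ b c := fun z => by
      simp only [add_dotProduct, smul_dotProduct, hu, hu1, smul_eq_mul, mul_one, mul_zero, add_zero]
      have h2 : ∀ t : F, ∑ s : F, φ (z ⬝ᵥ v + t) (z ⬝ᵥ w + t * u' ⬝ᵥ w + s * u ⬝ᵥ w) =
          ∑ c, φ (z ⬝ᵥ v + t) c := fun t => by
        refine Eq.trans (Finset.sum_congr rfl fun s _ => ?_)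
          (sum_comp_affine hu' (z ⬝ᵥ w + t * u' ⬝ᵥ w) _)
        congr 1; ring
      simp only [h2]
      simpa only [add_comm] using sum_comp_add (z ⬝ᵥ v) fun b => ∑ c, φ b c
    rw [Finset.sum_congr rfl fun z _ => h1 z]
    simp

end Averaging

section Distribution

variable {F : Type*} [Field F] [Fintype F] [DecidableEq F]

theorem exists_sum_comp_dotProduct_self (hF : ringChar F ≠ 2) (m : ℕ) :
    ∃ e : ℤ, (e = 1 ∨ e = -1) ∧ ∀ φ : F → ℤ,
      Fintype.card F * ∑ x : Fin (2 * m) → F, φ (x ⬝ᵥ x) =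
        ((Fintype.card F : ℤ) ^ (2 * m) - e * (Fintype.card F : ℤ) ^ m) * ∑ c, φ c +
          e * (Fintype.card F : ℤ) ^ (m + 1) * φ 0 := by
  obtain ⟨e, he, h⟩ := exists_sum_comp_diagonal hF m (fun _ => 1) fun _ => one_ne_zero
  refine ⟨e, he, fun φ => ?_⟩
  rw [← h]
  simp only [dotProduct, one_mul, pow_two]

end Distribution

section PairCorrelation

variable {F : Type*} [Field F] [Fintype F] {n : ℕ}

/-- The correlation of the signs of the distances to `0` and to `v`. -/
noncomputable def pairCorr (v : Fin n → F) : ℤ :=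
  ∑ w : Fin n → F, squareSign (w ⬝ᵥ w) * squareSign ((w - v) ⬝ᵥ (w - v))

omit [Fintype F] in
theorem dotProduct_self_add_smul (z v : Fin n → F) (t : F) :
    (z + t • v) ⬝ᵥ (z + t • v) = z ⬝ᵥ z + t * (2 * z ⬝ᵥ v) + t ^ 2 * v ⬝ᵥ v := by
  simp only [add_dotProduct, dotProduct_add, smul_dotProduct, dotProduct_smul, smul_eq_mul,
    dotProduct_comm v z]
  ring

omit [Fintype F] in
theorem dotProduct_self_sub (z v : Fin n → F) :
    (z - v) ⬝ᵥ (z - v) = z ⬝ᵥ z - 2 * z ⬝ᵥ v + v ⬝ᵥ v := by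
  simp only [sub_dotProduct, dotProduct_sub, dotProduct_comm v z]
  ring

omit [Fintype F] in
theorem dotProduct_self_add_smul_eq_complete_square {v : Fin n → F} (hv : v ⬝ᵥ v ≠ 0)
    (z : Fin n → F) (t : F) :
    (z + t • v) ⬝ᵥ (z + t • v) =
      v ⬝ᵥ v * (t + z ⬝ᵥ v / v ⬝ᵥ v) ^ 2 + (z ⬝ᵥ z - (z ⬝ᵥ v) ^ 2 / v ⬝ᵥ v) := by
  rw [dotProduct_self_add_smul]
  field_simp
  ring

theorem sum_comp_two_mul_dotProduct (hF : ringChar F ≠ 2) {v : Fin n → F} (hv : v ≠ 0)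
    (φ : F → ℤ) :
    Fintype.card F * ∑ z : Fin n → F, φ (2 * z ⬝ᵥ v) = (Fintype.card F : ℤ) ^ n * ∑ c, φ c := by
  rw [card_mul_sum_comp_dotProduct hv fun b => φ (2 * b)]
  congr 1
  simpa using sum_comp_affine (Ring.two_ne_zero hF) 0 φ

theorem card_sq_mul_pairCorr_of_isotropic (hF : ringChar F ≠ 2) {v : Fin n → F} (hv : v ≠ 0)
    (h0 : v ⬝ᵥ v = 0) :
    (Fintype.card F : ℤ) ^ 2 * pairCorr v = (Fintype.card F : ℤ) ^ n := by
  have key : ∀ z : Fin n → F, ∑ t : F, squareSign ((z + t • v) ⬝ᵥ (z + t • v)) *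
      squareSign ((z + t • v - v) ⬝ᵥ (z + t • v - v)) = squareCorr (2 * z ⬝ᵥ v) := fun z => by
    have h1 : ∀ t : F, squareSign ((z + t • v) ⬝ᵥ (z + t • v)) *
      squareSign ((z + t • v - v) ⬝ᵥ (z + t • v - v)) =
        squareSign (2 * z ⬝ᵥ v * t + z ⬝ᵥ z) *
          squareSign (2 * z ⬝ᵥ v * t + z ⬝ᵥ z - 2 * z ⬝ᵥ v) := fun t => by
      rw [dotProduct_self_sub, dotProduct_self_add_smul, add_dotProduct, smul_dotProduct, h0,
        smul_eq_mul]
      congr 2 <;> ring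
    simp only [h1]
    by_cases hb : 2 * z ⬝ᵥ v = 0
    · simp [hb, squareCorr_zero, squareSign_mul_self]
    · exact sum_comp_affine hb (z ⬝ᵥ z) fun a => squareSign a * squareSign (a - 2 * z ⬝ᵥ v)
  rw [pow_two, mul_assoc, pairCorr, card_mul_sum_eq_sum_sum v]
  simp only [key]
  rw [sum_comp_two_mul_dotProduct hF hv, sum_squareCorr hF, mul_one]

theorem card_mul_pairCorr_of_not_isotropic {v : Fin n → F} (hv : v ⬝ᵥ v ≠ 0) :
    Fintype.card F * pairCorr v = ∑ y : Fin n → F, ∑ x : F,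
      squareSign (v ⬝ᵥ v * x ^ 2 + (y ⬝ᵥ y - (y ⬝ᵥ v) ^ 2 / v ⬝ᵥ v)) *
        squareSign (v ⬝ᵥ v * (x - 1) ^ 2 + (y ⬝ᵥ y - (y ⬝ᵥ v) ^ 2 / v ⬝ᵥ v)) := by
  rw [pairCorr, card_mul_sum_eq_sum_sum v]
  refine Finset.sum_congr rfl fun y _ => ?_
  refine Eq.trans (Finset.sum_congr rfl fun t _ => ?_) (sum_comp_add (y ⬝ᵥ v / v ⬝ᵥ v) _)
  have : y + t • v - v = y + (t - 1) • v := by rw [sub_smul, one_smul, add_sub_assoc]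
  rw [this, dotProduct_self_add_smul_eq_complete_square hv,
    dotProduct_self_add_smul_eq_complete_square hv]
  congr 4; ring

theorem exists_sum_comp_orthogonal_part_odd (hF : ringChar F ≠ 2) {m : ℕ}
    {v : Fin (2 * m + 1) → F} (hv : v ⬝ᵥ v ≠ 0) :
    ∃ e : ℤ, (e = 1 ∨ e = -1) ∧ ∀ φ : F → ℤ,
      ∑ y : Fin (2 * m + 1) → F, φ (y ⬝ᵥ y - (y ⬝ᵥ v) ^ 2 / v ⬝ᵥ v) =
        ((Fintype.card F : ℤ) ^ (2 * m) - e * (Fintype.card F : ℤ) ^ m) * ∑ c, φ c +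
          e * (Fintype.card F : ℤ) ^ (m + 1) * φ 0 := by
  classical
  have hq : (Fintype.card F : ℤ) ≠ 0 := by simp
  set α := v ⬝ᵥ v with hα
  obtain ⟨e, he, h⟩ := exists_sum_comp_diagonal hF (m + 1)
    (Fin.cons (-α) (fun _ => 1) : Fin (2 * m + 1 + 1) → F)
    (Fin.cases (by simpa using hv) fun i => by simp)
  refine ⟨e, he, fun φ => ?_⟩
  have h1 : ∑ x : Fin (2 * m + 1 + 1) → F, φ (∑ i : Fin (2 * m + 1 + 1),
      (Fin.cons (-α) (fun _ => 1) : Fin (2 * m + 1 + 1) → F) i * x i ^ 2) =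
      ∑ y : Fin (2 * m + 1) → F, ∑ x : F, φ (y ⬝ᵥ y + -α * x ^ 2) := by
    rw [← (Fin.consEquiv fun _ : Fin (2 * m + 2) => F).sum_comp, Fintype.sum_prod_type,
      Finset.sum_comm]
    refine Finset.sum_congr rfl fun y _ => Finset.sum_congr rfl fun x _ => ?_
    rw [Fin.sum_univ_succ, add_comm]
    simp [dotProduct, Fin.consEquiv, pow_two]
  have h2 : ∀ y : Fin (2 * m + 1) → F, ∑ t : F, ∑ x : F,
      φ ((y + t • v) ⬝ᵥ (y + t • v) + -α * x ^ 2) =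
      (Fintype.card F - 1) * ∑ c, φ c +
        Fintype.card F * φ (y ⬝ᵥ y - (y ⬝ᵥ v) ^ 2 / v ⬝ᵥ v) := fun y => by
    have h3 := sum_comp_binary hF hv (neg_ne_zero.2 hv)
      fun c => φ (c + (y ⬝ᵥ y - (y ⬝ᵥ v) ^ 2 / v ⬝ᵥ v))
    rw [sum_comp_add, zero_add, show -(α * -α) = α ^ 2 by ring,
      quadraticChar_sq_one' hv, one_mul] at h3
    rw [← h3]
    refine Eq.trans ?_ (sum_comp_add (y ⬝ᵥ v / v ⬝ᵥ v) _)
    refine Finset.sum_congr rfl fun t _ => Finset.sum_congr rfl fun x _ => ?_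
    rw [dotProduct_self_add_smul_eq_complete_square hv, hα]
    congr 1; ring
  have h4 := h φ
  change (Fintype.card F : ℤ) * ∑ x : Fin (2 * m + 1 + 1) → F, φ (∑ i : Fin (2 * m + 1 + 1),
      (Fin.cons (-α) (fun _ => 1) : Fin (2 * m + 1 + 1) → F) i * x i ^ 2) = _ at h4
  rw [h1, card_mul_sum_eq_sum_sum v, Finset.sum_congr rfl fun y _ => h2 y,
    Finset.sum_add_distrib] at h4
  simp only [Finset.sum_const, Finset.card_univ, Fintype.card_pi_const, nsmul_eq_mul,
    ← Finset.mul_sum] at h4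
  push_cast at h4
  refine mul_left_cancel₀ hq ?_
  rw [← hα] at h4
  linear_combination h4

theorem card_sq_mul_pairCorr_ne_of_not_isotropic (hF : ringChar F ≠ 2) {m : ℕ}
    {v : Fin (2 * m + 1) → F} (hv : v ⬝ᵥ v ≠ 0) :
    (Fintype.card F : ℤ) ^ 2 * pairCorr v ≠ (Fintype.card F : ℤ) ^ (2 * m + 1) := by
  obtain ⟨e, he, h⟩ := exists_sum_comp_orthogonal_part_odd hF hv
  have h1 := card_mul_pairCorr_of_not_isotropic hv
  rw [h fun c => ∑ x : F, squareSign (v ⬝ᵥ v * x ^ 2 + c) *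
    squareSign (v ⬝ᵥ v * (x - 1) ^ 2 + c), Finset.sum_comm] at h1
  have h2 : ∀ x : F, ∑ c, squareSign (v ⬝ᵥ v * x ^ 2 + c) *
      squareSign (v ⬝ᵥ v * (x - 1) ^ 2 + c) =
      squareCorr (2 * v ⬝ᵥ v * x + -(v ⬝ᵥ v)) := fun x => by
    refine Eq.trans (Finset.sum_congr rfl fun c _ => ?_) (sum_comp_add (v ⬝ᵥ v * x ^ 2) _)
    congr 2 <;> ring
  simp only [h2] at h1
  rw [sum_comp_affine (mul_ne_zero (Ring.two_ne_zero hF) hv), sum_squareCorr hF] at h1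
  generalize (∑ x : F, squareSign (v ⬝ᵥ v * x ^ 2 + 0) *
    squareSign (v ⬝ᵥ v * (x - 1) ^ 2 + 0)) = P at h1
  intro h3
  have hq : 1 < (Fintype.card F : ℤ) := by exact_mod_cast Fintype.one_lt_card
  generalize (Fintype.card F : ℤ) = q at *
  have h4 : e * q ^ (m + 1) * (q * P - 1) = 0 := by linear_combination h3 - q * h1
  have h5 : q * P = 1 := by
    rcases mul_eq_zero.1 h4 with h | h
    · rcases he with rfl | rfl <;> simp at h <;> omega
    · linarith
  have := Int.eq_one_or_neg_one_of_mul_eq_one h5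
  omega

end PairCorrelation

section TripleCorrelation

variable {F : Type*} [Field F] [Fintype F] {n : ℕ}

/-- The correlation of the signs of the distances to `0`, to `v` and to `u`. -/
noncomputable def tripleCorr (v u : Fin n → F) : ℤ :=
  ∑ w : Fin n → F, squareSign (w ⬝ᵥ w) * squareSign ((w - v) ⬝ᵥ (w - v)) *
    squareSign ((w - u) ⬝ᵥ (w - u))

theorem sum_comp_dotProduct_self_of_orthogonal [DecidableEq F] (hF : ringChar F ≠ 2) {k : ℕ}
    {e : ℤ}
    (h : ∀ φ : F → ℤ, Fintype.card F * ∑ x : Fin (2 * (k + 1)) → F, φ (x ⬝ᵥ x) =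
        ((Fintype.card F : ℤ) ^ (2 * (k + 1)) - e * (Fintype.card F : ℤ) ^ (k + 1)) * ∑ c, φ c +
          e * (Fintype.card F : ℤ) ^ (k + 1 + 1) * φ 0)
    {v : Fin (2 * (k + 1)) → F} (hv : v ≠ 0) (h0 : v ⬝ᵥ v = 0) (φ : F → ℤ) :
    ∑ z : Fin (2 * (k + 1)) → F, (if 2 * z ⬝ᵥ v = 0 then φ (z ⬝ᵥ z) else 0) =
      ((Fintype.card F : ℤ) ^ (2 * k) - e * (Fintype.card F : ℤ) ^ k) * ∑ c, φ c +
        e * (Fintype.card F : ℤ) ^ (k + 1) * φ 0 := by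
  have hq : (Fintype.card F : ℤ) ≠ 0 := by simp
  have h1 : ∀ z : Fin (2 * (k + 1)) → F, ∑ t : F, φ ((z + t • v) ⬝ᵥ (z + t • v)) =
      Fintype.card F * (if 2 * z ⬝ᵥ v = 0 then φ (z ⬝ᵥ z) else 0) +
        (if 2 * z ⬝ᵥ v = 0 then 0 else 1) * ∑ c, φ c := fun z => by
    have h2 : ∀ t : F, φ ((z + t • v) ⬝ᵥ (z + t • v)) = φ (2 * z ⬝ᵥ v * t + z ⬝ᵥ z) :=
      fun t => by rw [dotProduct_self_add_smul, h0]; congr 1; ring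
    simp only [h2]
    split_ifs with hb
    · simp [hb]
    · simpa using sum_comp_affine hb (z ⬝ᵥ z) φ
  have h3 := card_mul_sum_eq_sum_sum v fun x => φ (x ⬝ᵥ x)
  rw [h, Finset.sum_congr rfl fun z _ => h1 z, Finset.sum_add_distrib, ← Finset.mul_sum,
    ← Finset.sum_mul] at h3
  have h4 := sum_comp_two_mul_dotProduct hF hv fun b => if b = 0 then 0 else 1
  have h5 : ∑ b : F, (if b = 0 then (0 : ℤ) else 1) = Fintype.card F - 1 := by
    rw [Finset.sum_congr rfl (g := fun b : F => (1 : ℤ) - if b = 0 then 1 else 0)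
      fun b _ => by split_ifs <;> rfl, Finset.sum_sub_distrib]
    simp
  rw [h5] at h4
  refine mul_left_cancel₀ (pow_ne_zero 2 hq) ?_
  linear_combination (-(Fintype.card F : ℤ)) * h3 - (∑ c, φ c) * h4

theorem card_mul_tripleCorr {v : Fin n → F} (h0 : v ⬝ᵥ v = 0) (u : Fin n → F) :
    Fintype.card F * tripleCorr v u = ∑ z : Fin n → F, ∑ t : F,
      squareSign (2 * z ⬝ᵥ v * t + z ⬝ᵥ z) * squareSign (2 * z ⬝ᵥ v * t + z ⬝ᵥ z - 2 * z ⬝ᵥ v) *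
        squareSign ((z - u) ⬝ᵥ (z - u) + t * (2 * z ⬝ᵥ v - 2 * u ⬝ᵥ v)) := by
  rw [tripleCorr, card_mul_sum_eq_sum_sum v]
  refine Finset.sum_congr rfl fun z _ => Finset.sum_congr rfl fun t _ => ?_
  rw [dotProduct_self_sub _ v, show z + t • v - u = (z - u) + t • v by abel,
    dotProduct_self_add_smul, dotProduct_self_add_smul, add_dotProduct, smul_dotProduct, h0,
    sub_dotProduct z u v]
  simp only [smul_eq_mul, mul_zero, add_zero]
  congr 3 <;> ring

theorem exists_card_mul_tripleCorr_of_orthogonal [DecidableEq F] (hF : ringChar F ≠ 2) {j : ℕ}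
    {e : ℤ}
    (h : ∀ φ : F → ℤ, Fintype.card F * ∑ x : Fin (2 * (j + 1 + 1)) → F, φ (x ⬝ᵥ x) =
        ((Fintype.card F : ℤ) ^ (2 * (j + 1 + 1)) -
          e * (Fintype.card F : ℤ) ^ (j + 1 + 1)) * ∑ c, φ c +
          e * (Fintype.card F : ℤ) ^ (j + 1 + 1 + 1) * φ 0)
    {v : Fin (2 * (j + 1 + 1)) → F} (hv : v ≠ 0) (h0 : v ⬝ᵥ v = 0)
    {u : Fin (2 * (j + 1 + 1)) → F} (hu : u ⬝ᵥ v = 0) :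
    ∃ K : ℤ, Fintype.card F * tripleCorr v u = (Fintype.card F : ℤ) ^ (j + 2) * K := by
  have hq : (Fintype.card F : ℤ) ≠ 0 := by simp
  obtain ⟨K, hK⟩ := card_sq_dvd_sum_comp_dotProduct (w := u) hv fun b d =>
    if 2 * b = 0 then 0 else
      ∑ a, squareSign a * squareSign (a - 2 * b) * squareSign (a + (u ⬝ᵥ u - 2 * d))
  have h1 : ∀ z : Fin (2 * (j + 1 + 1)) → F, ∑ t : F,
      squareSign (2 * z ⬝ᵥ v * t + z ⬝ᵥ z) * squareSign (2 * z ⬝ᵥ v * t + z ⬝ᵥ z - 2 * z ⬝ᵥ v) *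
        squareSign ((z - u) ⬝ᵥ (z - u) + t * (2 * z ⬝ᵥ v - 2 * u ⬝ᵥ v)) =
      Fintype.card F * (if 2 * z ⬝ᵥ v = 0 then squareSign ((z - u) ⬝ᵥ (z - u)) else 0) +
      if 2 * z ⬝ᵥ v = 0 then 0 else ∑ a, squareSign a * squareSign (a - 2 * z ⬝ᵥ v) *
        squareSign (a + (u ⬝ᵥ u - 2 * z ⬝ᵥ u)) := fun z => by
    split_ifs with hb
    · simp [hb, hu, squareSign_mul_self]
    · rw [mul_zero, zero_add]
      refine Eq.trans ?_ (sum_comp_affine hb (z ⬝ᵥ z) _)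
      refine Finset.sum_congr rfl fun t _ => ?_
      rw [dotProduct_self_sub, hu]
      congr 2; ring
  have h2 : ∑ z : Fin (2 * (j + 1 + 1)) → F,
      (if 2 * z ⬝ᵥ v = 0 then squareSign ((z - u) ⬝ᵥ (z - u)) else 0) =
      ∑ z : Fin (2 * (j + 1 + 1)) → F, (if 2 * z ⬝ᵥ v = 0 then squareSign (z ⬝ᵥ z) else 0) := by
    rw [← Equiv.sum_comp (Equiv.addRight u)]
    refine Finset.sum_congr rfl fun z _ => ?_
    simp only [Equiv.coe_addRight, add_dotProduct z u v, hu, add_zero, add_sub_cancel_right]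
  rw [card_mul_tripleCorr h0, Finset.sum_congr rfl fun z _ => h1 z, Finset.sum_add_distrib,
    ← Finset.mul_sum, h2, sum_comp_dotProduct_self_of_orthogonal hF h hv h0]
  refine ⟨((Fintype.card F : ℤ) ^ (j + 1) - e) * ∑ c : F, squareSign c +
    e * Fintype.card F * squareSign (0 : F) + (Fintype.card F : ℤ) ^ j * K, ?_⟩
  refine mul_left_cancel₀ (pow_ne_zero 2 hq) ?_
  rw [mul_add, hK]
  ring

theorem exists_card_mul_tripleCorr_of_not_orthogonal [DecidableEq F] (hF : ringChar F ≠ 2)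
    {j : ℕ} {e : ℤ}
    (h : ∀ φ : F → ℤ, Fintype.card F * ∑ x : Fin (2 * (j + 1 + 1)) → F, φ (x ⬝ᵥ x) =
        ((Fintype.card F : ℤ) ^ (2 * (j + 1 + 1)) -
          e * (Fintype.card F : ℤ) ^ (j + 1 + 1)) * ∑ c, φ c +
          e * (Fintype.card F : ℤ) ^ (j + 1 + 1 + 1) * φ 0)
    {v : Fin (2 * (j + 1 + 1)) → F} (hv : v ≠ 0) (h0 : v ⬝ᵥ v = 0)
    {u : Fin (2 * (j + 1 + 1)) → F} (hu : u ⬝ᵥ v ≠ 0) :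
    ∃ K : ℤ, Fintype.card F * tripleCorr v u =
      -e * (Fintype.card F : ℤ) ^ (j + 1) + (Fintype.card F : ℤ) ^ (j + 2) * K := by
  have hq : (Fintype.card F : ℤ) ≠ 0 := by simp
  have h2F : (2 : F) ≠ 0 := Ring.two_ne_zero hF
  have hβ : 2 * u ⬝ᵥ v ≠ 0 := mul_ne_zero h2F hu
  set β := 2 * u ⬝ᵥ v with hβdef
  let G : F → (Fin (2 * (j + 1 + 1)) → F) → ℤ := fun b z =>
    ∑ a, squareSign a * squareSign (a - b) *
      squareSign ((z - u) ⬝ᵥ (z - u) + (a - z ⬝ᵥ z) * (1 - β / b))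
  have h1 : ∀ z : Fin (2 * (j + 1 + 1)) → F, ∑ t : F,
      squareSign (2 * z ⬝ᵥ v * t + z ⬝ᵥ z) * squareSign (2 * z ⬝ᵥ v * t + z ⬝ᵥ z - 2 * z ⬝ᵥ v) *
        squareSign ((z - u) ⬝ᵥ (z - u) + t * (2 * z ⬝ᵥ v - β)) =
      (if 2 * z ⬝ᵥ v = 0 then 1 else 0) +
        ∑ b : F, if b = 0 then 0 else if 2 * z ⬝ᵥ v = b then G b z else 0 := fun z => by
    by_cases hb : 2 * z ⬝ᵥ v = 0
    · have h2 : ∀ b : F, (if b = 0 then 0 else if 2 * z ⬝ᵥ v = b then G b z else 0) = 0 := by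
        intro b
        rw [hb]
        split_ifs with h1 h2
        · rfl
        · exact absurd h2.symm h1
        · rfl
      rw [Finset.sum_eq_zero fun b _ => h2 b]
      simp only [hb, zero_mul, zero_add, sub_zero,
        squareSign_mul_self, one_mul, if_true, zero_sub, add_zero]
      have := sum_comp_affine (neg_ne_zero.2 hβ) ((z - u) ⬝ᵥ (z - u)) squareSign
      rw [sum_squareSign hF] at this
      refine (Finset.sum_congr rfl fun t _ => ?_).trans this
      congr 1; ring
    · have h2 : ∑ b : F, (if b = 0 then 0 else if 2 * z ⬝ᵥ v = b then G b z else 0) =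
          G (2 * z ⬝ᵥ v) z := by
        rw [Finset.sum_eq_single (2 * z ⬝ᵥ v), if_neg hb, if_pos rfl]
        · intro b _ hb'
          rw [if_neg (Ne.symm hb'), ite_self]
        · simp
      have hz : z ⬝ᵥ v ≠ 0 := right_ne_zero_of_mul hb
      rw [if_neg hb, zero_add, h2]
      refine Eq.trans ?_ (sum_comp_affine hb (z ⬝ᵥ z) _)
      refine Finset.sum_congr rfl fun t _ => ?_
      congr 2; field_simp; ring
  have h3 : ∀ b : F, b ≠ 0 → ∑ z : Fin (2 * (j + 1 + 1)) → F,
      (if 2 * z ⬝ᵥ v = b then G b z else 0) =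
      ((Fintype.card F : ℤ) ^ (2 * (j + 1)) - e * (Fintype.card F : ℤ) ^ (j + 1)) *
          squareCorr b +
        e * (Fintype.card F : ℤ) ^ (j + 2) * ∑ a, squareSign a * squareSign (a - b) *
          squareSign ((1 - b / β) * u ⬝ᵥ u + a * (1 - β / b)) := fun b hb => by
    rw [← Equiv.sum_comp (Equiv.addRight ((b / β) • u))]
    have h4 : ∀ z : Fin (2 * (j + 1 + 1)) → F,
        (if 2 * (Equiv.addRight ((b / β) • u) z) ⬝ᵥ v = b then
          G b (Equiv.addRight ((b / β) • u) z) else 0) =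
        ∑ a, squareSign a * squareSign (a - b) * (if 2 * z ⬝ᵥ v = 0 then
          squareSign (β / b * z ⬝ᵥ z + ((1 - b / β) * u ⬝ᵥ u + a * (1 - β / b))) else 0) :=
        fun z => by
      have h5 : 2 * (z + (b / β) • u) ⬝ᵥ v = b ↔ 2 * z ⬝ᵥ v = 0 := by
        have : 2 * (z + (b / β) • u) ⬝ᵥ v = 2 * z ⬝ᵥ v + b := by
          rw [add_dotProduct, smul_dotProduct, mul_add, smul_eq_mul, mul_left_comm, ← hβdef,
            div_mul_cancel₀ _ hβ]
        rw [this, add_eq_right]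
      simp only [Equiv.coe_addRight, h5, G]
      split_ifs with hz
      · refine Finset.sum_congr rfl fun a _ => ?_
        rw [dotProduct_self_sub, dotProduct_self_add_smul, add_dotProduct, smul_dotProduct,
          smul_eq_mul]
        congr 2; field_simp; ring
      · simp
    have h6 : ∀ a : F, ∑ z : Fin (2 * (j + 1 + 1)) → F, (if 2 * z ⬝ᵥ v = 0 then
          squareSign (β / b * z ⬝ᵥ z + ((1 - b / β) * u ⬝ᵥ u + a * (1 - β / b))) else 0) =
        ((Fintype.card F : ℤ) ^ (2 * (j + 1)) - e * (Fintype.card F : ℤ) ^ (j + 1)) +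
        e * (Fintype.card F : ℤ) ^ (j + 2) *
          squareSign ((1 - b / β) * u ⬝ᵥ u + a * (1 - β / b)) := fun a => by
      rw [sum_comp_dotProduct_self_of_orthogonal hF h hv h0 fun x =>
        squareSign (β / b * x + ((1 - b / β) * u ⬝ᵥ u + a * (1 - β / b))),
        sum_comp_affine (div_ne_zero hβ hb), sum_squareSign hF]
      simp
    simp only [h4]
    rw [Finset.sum_comm]
    simp only [← Finset.mul_sum, h6]
    rw [squareCorr, Finset.mul_sum, Finset.mul_sum, ← Finset.sum_add_distrib]
    refine Finset.sum_congr rfl fun a _ => ?_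
    ring
  have h7 := sum_comp_two_mul_dotProduct hF hv fun b => if b = 0 then 1 else 0
  rw [Finset.sum_ite_eq' _ _ _, if_pos (Finset.mem_univ _)] at h7
  have h8 : ∑ b : F, (if b = 0 then 0 else squareCorr b) = 1 - Fintype.card F := by
    have h11 : ∀ b : F, (if b = 0 then 0 else squareCorr b) =
        squareCorr b - if b = 0 then squareCorr (0 : F) else 0 := fun b => by
      split_ifs with hb <;> simp [hb]
    rw [← sum_squareCorr hF, ← squareCorr_zero (F := F), Finset.sum_congr rfl fun b _ => h11 b,
      Finset.sum_sub_distrib]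
    simp
  have h9 := card_mul_tripleCorr h0 u
  have h12 : ∀ b : F, (∑ z : Fin (2 * (j + 1 + 1)) → F,
      if b = 0 then 0 else if 2 * z ⬝ᵥ v = b then G b z else 0) = if b = 0 then 0 else
      ((Fintype.card F : ℤ) ^ (2 * (j + 1)) - e * (Fintype.card F : ℤ) ^ (j + 1)) *
          squareCorr b +
        e * (Fintype.card F : ℤ) ^ (j + 2) * ∑ a, squareSign a * squareSign (a - b) *
          squareSign ((1 - b / β) * u ⬝ᵥ u + a * (1 - β / b)) := fun b => by
    by_cases hb : b = 0
    · simp [hb]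
    · simp only [hb, if_false, h3 b hb]
  have h10 : ∀ b : F, (if b = 0 then 0 else
      ((Fintype.card F : ℤ) ^ (2 * (j + 1)) - e * (Fintype.card F : ℤ) ^ (j + 1)) *
          squareCorr b +
        e * (Fintype.card F : ℤ) ^ (j + 2) * ∑ a, squareSign a * squareSign (a - b) *
          squareSign ((1 - b / β) * u ⬝ᵥ u + a * (1 - β / b))) =
      ((Fintype.card F : ℤ) ^ (2 * (j + 1)) - e * (Fintype.card F : ℤ) ^ (j + 1)) *
          (if b = 0 then 0 else squareCorr b) +
      e * (Fintype.card F : ℤ) ^ (j + 2) * (if b = 0 then 0 else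
        ∑ a, squareSign a * squareSign (a - b) *
          squareSign ((1 - b / β) * u ⬝ᵥ u + a * (1 - β / b))) := fun b => by
    split_ifs <;> simp
  have h13 : ∑ z : Fin (2 * (j + 1 + 1)) → F, ∑ b : F,
      (if b = 0 then 0 else if 2 * z ⬝ᵥ v = b then G b z else 0) = _ :=
    Finset.sum_comm.trans (Finset.sum_congr rfl fun b _ => (h12 b).trans (h10 b))
  rw [Finset.sum_congr rfl fun z _ => h1 z, Finset.sum_add_distrib, h13,
    Finset.sum_add_distrib] at h9
  rw [← Finset.mul_sum, ← Finset.mul_sum, h8] at h9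
  generalize (∑ b : F, if b = 0 then 0 else ∑ a, squareSign a * squareSign (a - b) *
    squareSign ((1 - b / β) * u ⬝ᵥ u + a * (1 - β / b))) = M at h9
  refine ⟨(Fintype.card F : ℤ) ^ (j + 1) + (1 - Fintype.card F) * (Fintype.card F : ℤ) ^ j + e +
    e * M, ?_⟩
  refine mul_left_cancel₀ hq ?_
  linear_combination (Fintype.card F : ℤ) * h9 + h7

end TripleCorrelation

section NonisotropicTriple

variable {F : Type*} [Field F] [Fintype F] {n : ℕ}

omit [Fintype F] in
theorem dotProduct_self_add_smul_add_smul {v u : Fin n → F} (hv : v ⬝ᵥ v ≠ 0) (hu : u ⬝ᵥ u ≠ 0)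
    (huv : u ⬝ᵥ v = 0) (z : Fin n → F) (s t : F) :
    (z + s • v + t • u) ⬝ᵥ (z + s • v + t • u) =
      v ⬝ᵥ v * (s + z ⬝ᵥ v / v ⬝ᵥ v) ^ 2 + u ⬝ᵥ u * (t + z ⬝ᵥ u / u ⬝ᵥ u) ^ 2 +
        (z ⬝ᵥ z - (z ⬝ᵥ v) ^ 2 / v ⬝ᵥ v - (z ⬝ᵥ u) ^ 2 / u ⬝ᵥ u) := by
  rw [dotProduct_self_add_smul, dotProduct_self_add_smul, add_dotProduct, smul_dotProduct,
    dotProduct_comm v u, huv, smul_eq_mul]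
  field_simp
  ring

theorem sum_sum_comp_add_smul_add_smul {v u : Fin n → F} (hv : v ⬝ᵥ v ≠ 0)
    (hu : u ⬝ᵥ u ≠ 0) (huv : u ⬝ᵥ v = 0) (z : Fin n → F) (φ : F → F → F → ℤ) :
    ∑ s : F, ∑ t : F, φ ((z + s • v + t • u) ⬝ᵥ (z + s • v + t • u))
      ((z + s • v + t • u - v) ⬝ᵥ (z + s • v + t • u - v))
      ((z + s • v + t • u - u) ⬝ᵥ (z + s • v + t • u - u)) =
    ∑ s : F, ∑ t : F, φ
      (v ⬝ᵥ v * s ^ 2 + u ⬝ᵥ u * t ^ 2 +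
        (z ⬝ᵥ z - (z ⬝ᵥ v) ^ 2 / v ⬝ᵥ v - (z ⬝ᵥ u) ^ 2 / u ⬝ᵥ u))
      (v ⬝ᵥ v * (s - 1) ^ 2 + u ⬝ᵥ u * t ^ 2 +
        (z ⬝ᵥ z - (z ⬝ᵥ v) ^ 2 / v ⬝ᵥ v - (z ⬝ᵥ u) ^ 2 / u ⬝ᵥ u))
      (v ⬝ᵥ v * s ^ 2 + u ⬝ᵥ u * (t - 1) ^ 2 +
        (z ⬝ᵥ z - (z ⬝ᵥ v) ^ 2 / v ⬝ᵥ v - (z ⬝ᵥ u) ^ 2 / u ⬝ᵥ u)) := by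
  refine Eq.trans ?_ (sum_comp_add (z ⬝ᵥ v / v ⬝ᵥ v) _)
  refine Finset.sum_congr rfl fun s _ => ?_
  refine Eq.trans ?_ (sum_comp_add (z ⬝ᵥ u / u ⬝ᵥ u) _)
  refine Finset.sum_congr rfl fun t _ => ?_
  have h1 : z + s • v + t • u - v = z + (s - 1) • v + t • u := by
    rw [sub_smul, one_smul]; abel
  have h2 : z + s • v + t • u - u = z + s • v + (t - 1) • u := by
    rw [sub_smul, one_smul]; abel
  rw [h1, h2, dotProduct_self_add_smul_add_smul hv hu huv,
    dotProduct_self_add_smul_add_smul hv hu huv, dotProduct_self_add_smul_add_smul hv hu huv]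
  congr 4 <;> ring

theorem exists_card_mul_tripleCorr_of_not_isotropic [DecidableEq F] (hF : ringChar F ≠ 2)
    {k : ℕ} {e : ℤ}
    (h : ∀ φ : F → ℤ, Fintype.card F * ∑ x : Fin (2 * (k + 1)) → F, φ (x ⬝ᵥ x) =
        ((Fintype.card F : ℤ) ^ (2 * (k + 1)) - e * (Fintype.card F : ℤ) ^ (k + 1)) * ∑ c, φ c +
          e * (Fintype.card F : ℤ) ^ (k + 1 + 1) * φ 0)
    {v u : Fin (2 * (k + 1)) → F} (hv : v ⬝ᵥ v ≠ 0) (hu : u ⬝ᵥ u ≠ 0) (huv : u ⬝ᵥ v = 0)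
    (hχ : quadraticChar F (-(v ⬝ᵥ v * u ⬝ᵥ u)) = -1) :
    ∃ P : ℤ, Fintype.card F * tripleCorr v u = (Fintype.card F : ℤ) ^ (2 * k) +
      e * (Fintype.card F : ℤ) ^ k - e * (Fintype.card F : ℤ) ^ (k + 1) * P := by
  have hq : (Fintype.card F : ℤ) ≠ 0 := by simp
  have h2 : (2 : F) ≠ 0 := Ring.two_ne_zero hF
  have hdist : ∀ φ : F → ℤ, ∑ z : Fin (2 * (k + 1)) → F,
      φ (z ⬝ᵥ z - (z ⬝ᵥ v) ^ 2 / v ⬝ᵥ v - (z ⬝ᵥ u) ^ 2 / u ⬝ᵥ u) =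
      ((Fintype.card F : ℤ) ^ (2 * k + 1) + e * (Fintype.card F : ℤ) ^ (k + 1)) * ∑ c, φ c -
        e * (Fintype.card F : ℤ) ^ (k + 2) * φ 0 := fun φ => by
    have h1 : ∀ z : Fin (2 * (k + 1)) → F,
        ∑ s : F, ∑ t : F, φ ((z + s • v + t • u) ⬝ᵥ (z + s • v + t • u)) =
        (Fintype.card F + 1) * ∑ c, φ c -
          Fintype.card F * φ (z ⬝ᵥ z - (z ⬝ᵥ v) ^ 2 / v ⬝ᵥ v - (z ⬝ᵥ u) ^ 2 / u ⬝ᵥ u) :=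
        fun z => by
      rw [sum_sum_comp_add_smul_add_smul hv hu huv z fun a _ _ => φ a,
        sum_comp_binary hF hv hu fun c =>
          φ (c + (z ⬝ᵥ z - (z ⬝ᵥ v) ^ 2 / v ⬝ᵥ v - (z ⬝ᵥ u) ^ 2 / u ⬝ᵥ u)), hχ, sum_comp_add,
        zero_add]
      ring
    have h3 := card_mul_sum_eq_sum_sum v fun x => ∑ t : F, φ ((x + t • u) ⬝ᵥ (x + t • u))
    rw [← card_mul_sum_eq_sum_sum u fun x => φ (x ⬝ᵥ x), Finset.sum_congr rfl fun z _ => h1 z, h,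
      Finset.sum_sub_distrib] at h3
    simp only [Finset.sum_const, Finset.card_univ, Fintype.card_pi_const, nsmul_eq_mul,
      ← Finset.mul_sum] at h3
    push_cast at h3
    refine mul_left_cancel₀ hq ?_
    linear_combination h3
  have h4 := card_mul_sum_eq_sum_sum v fun x => ∑ t : F,
    squareSign ((x + t • u) ⬝ᵥ (x + t • u)) *
      squareSign ((x + t • u - v) ⬝ᵥ (x + t • u - v)) *
      squareSign ((x + t • u - u) ⬝ᵥ (x + t • u - u))
  rw [← card_mul_sum_eq_sum_sum u fun w => squareSign (w ⬝ᵥ w) *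
    squareSign ((w - v) ⬝ᵥ (w - v)) * squareSign ((w - u) ⬝ᵥ (w - u)), ← tripleCorr,
    Finset.sum_congr rfl fun z _ => sum_sum_comp_add_smul_add_smul hv hu huv z fun a b c =>
      squareSign a * squareSign b * squareSign c,
    hdist fun c => ∑ s : F, ∑ t : F, squareSign (v ⬝ᵥ v * s ^ 2 + u ⬝ᵥ u * t ^ 2 + c) *
      squareSign (v ⬝ᵥ v * (s - 1) ^ 2 + u ⬝ᵥ u * t ^ 2 + c) *
      squareSign (v ⬝ᵥ v * s ^ 2 + u ⬝ᵥ u * (t - 1) ^ 2 + c)] at h4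
  have h5 : ∑ c : F, ∑ s : F, ∑ t : F, squareSign (v ⬝ᵥ v * s ^ 2 + u ⬝ᵥ u * t ^ 2 + c) *
      squareSign (v ⬝ᵥ v * (s - 1) ^ 2 + u ⬝ᵥ u * t ^ 2 + c) *
      squareSign (v ⬝ᵥ v * s ^ 2 + u ⬝ᵥ u * (t - 1) ^ 2 + c) = 1 := by
    rw [Finset.sum_comm, Finset.sum_congr rfl fun s _ => Finset.sum_comm]
    have h6 : ∀ s t : F, ∑ c : F, squareSign (v ⬝ᵥ v * s ^ 2 + u ⬝ᵥ u * t ^ 2 + c) *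
        squareSign (v ⬝ᵥ v * (s - 1) ^ 2 + u ⬝ᵥ u * t ^ 2 + c) *
        squareSign (v ⬝ᵥ v * s ^ 2 + u ⬝ᵥ u * (t - 1) ^ 2 + c) =
        ∑ a, squareSign a * squareSign (-2 * v ⬝ᵥ v * s + (a + v ⬝ᵥ v)) *
          squareSign (-2 * u ⬝ᵥ u * t + (a + u ⬝ᵥ u)) := fun s t => by
      refine Eq.trans (Finset.sum_congr rfl fun c _ => ?_)
        (sum_comp_add (v ⬝ᵥ v * s ^ 2 + u ⬝ᵥ u * t ^ 2) _)
      refine congrArg₂ _ (congrArg₂ _ (congrArg _ ?_) (congrArg _ ?_)) (congrArg _ ?_) <;> ring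
    simp only [h6]
    rw [Finset.sum_congr rfl fun s _ => Finset.sum_comm, Finset.sum_comm]
    simp only [← Finset.mul_sum, mul_assoc]
    simp only [← mul_assoc, sum_comp_affine (mul_ne_zero (neg_ne_zero.2 h2) hu),
      sum_squareSign hF, mul_one,
      sum_comp_affine (mul_ne_zero (neg_ne_zero.2 h2) hv)]
  rw [h5] at h4
  refine ⟨∑ s : F, ∑ t : F, squareSign (v ⬝ᵥ v * s ^ 2 + u ⬝ᵥ u * t ^ 2 + 0) *
      squareSign (v ⬝ᵥ v * (s - 1) ^ 2 + u ⬝ᵥ u * t ^ 2 + 0) *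
      squareSign (v ⬝ᵥ v * s ^ 2 + u ⬝ᵥ u * (t - 1) ^ 2 + 0), ?_⟩
  refine mul_left_cancel₀ hq ?_
  linear_combination h4

end NonisotropicTriple

section Geometry

variable {F : Type*} [Field F] {n : ℕ}

theorem exists_ne_zero_dotProduct_eq_zero_pair (hn : 3 ≤ n) (a c : Fin n → F) :
    ∃ x : Fin n → F, x ≠ 0 ∧ x ⬝ᵥ a = 0 ∧ x ⬝ᵥ c = 0 := by
  have h := LinearMap.ker_ne_bot_of_finrank_lt (f := Matrix.mulVecLin (Matrix.of ![a, c]))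
    (by simp; omega)
  obtain ⟨x, hx, hx0⟩ := Submodule.exists_mem_ne_zero_of_ne_bot h
  rw [LinearMap.mem_ker, Matrix.mulVecLin_apply] at hx
  refine ⟨x, hx0, ?_, ?_⟩
  · rw [dotProduct_comm]; simpa [Matrix.mulVec] using congrFun hx 0
  · rw [dotProduct_comm]; simpa [Matrix.mulVec] using congrFun hx 1

theorem exists_not_isotropic_of_projection (h2 : (2 : F) ≠ 0) (hn : 3 ≤ n) {a c : Fin n → F}
    (P : (Fin n → F) → Fin n → F) (ha : ∀ z, P z ⬝ᵥ a = 0) (hc : ∀ z, P z ⬝ᵥ c = 0)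
    (hP : ∀ x z, x ⬝ᵥ a = 0 → x ⬝ᵥ c = 0 → x ⬝ᵥ P z = x ⬝ᵥ z) :
    ∃ u : Fin n → F, u ⬝ᵥ a = 0 ∧ u ⬝ᵥ c = 0 ∧ u ⬝ᵥ u ≠ 0 := by
  by_contra! h
  obtain ⟨x, hx0, hxa, hxc⟩ := exists_ne_zero_dotProduct_eq_zero_pair hn a c
  obtain ⟨z, hz⟩ := exists_dotProduct_eq_one hx0
  have h1 := h (x + P z) (by rw [add_dotProduct, hxa, ha, add_zero])
    (by rw [add_dotProduct, hxc, hc, add_zero])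
  have h3 := dotProduct_self_add_smul x (P z) 1
  rw [one_smul, h1, h x hxa hxc, h (P z) (ha z) (hc z), hP x z hxa hxc, dotProduct_comm, hz] at h3
  apply h2
  linear_combination -h3

theorem exists_not_isotropic_orthogonal (h2 : (2 : F) ≠ 0) (hn : 3 ≤ n) {v : Fin n → F}
    (hv : v ⬝ᵥ v ≠ 0) : ∃ u : Fin n → F, u ⬝ᵥ v = 0 ∧ u ⬝ᵥ u ≠ 0 := by
  obtain ⟨u, hu, -, hu'⟩ := exists_not_isotropic_of_projection (a := v) (c := 0) h2 hn
    (fun z => z - (z ⬝ᵥ v / v ⬝ᵥ v) • v)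
    (fun z => by rw [sub_dotProduct, smul_dotProduct, smul_eq_mul, div_mul_cancel₀ _ hv, sub_self])
    (fun z => dotProduct_zero _)
    (fun x z hx _ => by rw [dotProduct_sub, dotProduct_smul, hx, smul_zero, sub_zero])
  exact ⟨u, hu, hu'⟩

theorem exists_not_isotropic_orthogonal_pair (h2 : (2 : F) ≠ 0) (hn : 3 ≤ n) {v w : Fin n → F}
    (hv : v ⬝ᵥ v ≠ 0) (hw : w ⬝ᵥ w ≠ 0) (hwv : w ⬝ᵥ v = 0) :
    ∃ u : Fin n → F, u ⬝ᵥ v = 0 ∧ u ⬝ᵥ w = 0 ∧ u ⬝ᵥ u ≠ 0 :=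
  exists_not_isotropic_of_projection h2 hn
    (fun z => z - (z ⬝ᵥ v / v ⬝ᵥ v) • v - (z ⬝ᵥ w / w ⬝ᵥ w) • w)
    (fun z => by
      simp only [sub_dotProduct, smul_dotProduct, smul_eq_mul, hwv]; field_simp; ring)
    (fun z => by
      simp only [sub_dotProduct, smul_dotProduct, smul_eq_mul, dotProduct_comm v w, hwv]
      field_simp; ring)
    (fun x z hx hx' => by
      simp only [dotProduct_sub, dotProduct_smul, hx, hx', smul_zero, sub_zero])

theorem exists_not_isotropic_orthogonal_hyperbolic (h2 : (2 : F) ≠ 0) (hn : 3 ≤ n)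
    {v f : Fin n → F} (hv : v ⬝ᵥ v = 0) (hf : f ⬝ᵥ f = 0) (hvf : v ⬝ᵥ f = 1) :
    ∃ u : Fin n → F, u ⬝ᵥ v = 0 ∧ u ⬝ᵥ f = 0 ∧ u ⬝ᵥ u ≠ 0 :=
  exists_not_isotropic_of_projection h2 hn
    (fun z => z - (z ⬝ᵥ f) • v - (z ⬝ᵥ v) • f)
    (fun z => by
      simp only [sub_dotProduct, smul_dotProduct, smul_eq_mul, hv, dotProduct_comm f v, hvf]; ring)
    (fun z => by
      simp only [sub_dotProduct, smul_dotProduct, smul_eq_mul, hf, hvf]; ring)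
    (fun x z hx hx' => by
      simp only [dotProduct_sub, dotProduct_smul, hx, hx', smul_zero, sub_zero])

theorem exists_quadraticChar_neg_mul [Fintype F] [DecidableEq F] (hF : ringChar F ≠ 2)
    (hn : 3 ≤ n) {v : Fin n → F} (hv : v ⬝ᵥ v ≠ 0) :
    ∃ u : Fin n → F, u ⬝ᵥ u ≠ 0 ∧ u ⬝ᵥ v = 0 ∧
      quadraticChar F (-(v ⬝ᵥ v * u ⬝ᵥ u)) = -1 := by
  have h2 : (2 : F) ≠ 0 := Ring.two_ne_zero hF
  obtain ⟨a, hav, ha⟩ := exists_not_isotropic_orthogonal h2 hn hv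
  obtain ⟨b, hbv, hba, hb⟩ := exists_not_isotropic_orthogonal_pair h2 hn hv ha hav
  obtain ⟨r, hr⟩ := quadraticChar_exists_neg_one hF
  have hr0 : r ≠ 0 := by rintro rfl; simp at hr
  have hc0 : -r / v ⬝ᵥ v ≠ 0 := div_ne_zero (neg_ne_zero.2 hr0) hv
  obtain ⟨x, y, hxy⟩ : ∃ x y : F, a ⬝ᵥ a * x ^ 2 + b ⬝ᵥ b * y ^ 2 = -r / v ⬝ᵥ v := by
    by_contra! h
    have h1 := sum_comp_binary hF ha hb fun c => if c = -r / v ⬝ᵥ v then 1 else 0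
    simp only [h, if_false, Finset.sum_const_zero, Finset.sum_ite_eq', Finset.mem_univ, if_true,
      hc0.symm, mul_zero, add_zero, mul_one] at h1
    have hq : 1 < (Fintype.card F : ℤ) := by exact_mod_cast Fintype.one_lt_card
    rcases quadraticChar_dichotomy (neg_ne_zero.2 (mul_ne_zero ha hb)) with h3 | h3 <;>
      rw [h3] at h1 <;> omega
  have hQ : (x • a + y • b) ⬝ᵥ (x • a + y • b) = -r / v ⬝ᵥ v := by
    rw [← hxy]
    simp only [add_dotProduct, dotProduct_add, smul_dotProduct, dotProduct_smul, smul_eq_mul, hba,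
      dotProduct_comm a b]
    ring
  refine ⟨x • a + y • b, by rwa [hQ], ?_, ?_⟩
  · simp [add_dotProduct, hav, hbv]
  · rw [hQ, mul_div_cancel₀ _ hv, neg_neg, hr]

end Geometry

section Integral

variable {F : Type*} [Field F] [Fintype F] {n : ℕ}

theorem pairCorr_sub (x y : Fin n → F) : pairCorr (x - y) = ∑ w : Fin n → F,
    squareSign ((w - y) ⬝ᵥ (w - y)) * squareSign ((w - x) ⬝ᵥ (w - x)) := by
  rw [pairCorr, ← Equiv.sum_comp (Equiv.subRight y)]
  simp only [Equiv.subRight_apply, sub_sub_sub_cancel_right]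

theorem tripleCorr_sub (x y z : Fin n → F) : tripleCorr (x - y) (z - y) = ∑ w : Fin n → F,
    squareSign ((w - y) ⬝ᵥ (w - y)) * squareSign ((w - x) ⬝ᵥ (w - x)) *
      squareSign ((w - z) ⬝ᵥ (w - z)) := by
  rw [tripleCorr, ← Equiv.sum_comp (Equiv.subRight y)]
  simp only [Equiv.subRight_apply, sub_sub_sub_cancel_right]

variable {γ : (Fin n → F) → (Fin n → F)}

theorem pairCorr_map_sub_map (hγ : Function.Bijective γ)
    (h : ∀ x y, IsSquare ((x - y) ⬝ᵥ (x - y)) ↔ IsSquare ((γ x - γ y) ⬝ᵥ (γ x - γ y)))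
    (x y : Fin n → F) : pairCorr (γ x - γ y) = pairCorr (x - y) := by
  rw [pairCorr_sub, pairCorr_sub, ← Equiv.sum_comp (Equiv.ofBijective γ hγ)]
  simp only [Equiv.ofBijective_apply, ← squareSign_congr (h _ _)]

theorem tripleCorr_map_sub_map (hγ : Function.Bijective γ)
    (h : ∀ x y, IsSquare ((x - y) ⬝ᵥ (x - y)) ↔ IsSquare ((γ x - γ y) ⬝ᵥ (γ x - γ y)))
    (x y z : Fin n → F) : tripleCorr (γ x - γ y) (γ z - γ y) = tripleCorr (x - y) (z - y) := by
  rw [tripleCorr_sub, tripleCorr_sub, ← Equiv.sum_comp (Equiv.ofBijective γ hγ)]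
  simp only [Equiv.ofBijective_apply, ← squareSign_congr (h _ _)]

theorem two_lt_card_of_ringChar_ne_two (hF : ringChar F ≠ 2) : 2 < Fintype.card F := by
  have h1 : 1 < Fintype.card F := Fintype.one_lt_card
  have h2 : Fintype.card F ≠ 2 := fun h => by
    have := FiniteField.even_card_iff_char_two (F := F)
    omega
  omega

/-- A bijection preserving integrality of distances maps pairs at distance zero to pairs at
distance zero. -/
theorem map_isotropic_of_integral (hF : ringChar F ≠ 2) (hn : 3 ≤ n)
    (hγ : Function.Bijective γ)
    (h : ∀ x y, IsSquare ((x - y) ⬝ᵥ (x - y)) ↔ IsSquare ((γ x - γ y) ⬝ᵥ (γ x - γ y)))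
    {x y : Fin n → F} (hxy : (x - y) ⬝ᵥ (x - y) = 0) : (γ x - γ y) ⬝ᵥ (γ x - γ y) = 0 := by
  classical
  rcases eq_or_ne x y with rfl | hne
  · simp
  have hne' : x - y ≠ 0 := sub_ne_zero.2 hne
  by_contra hγ0
  rcases Nat.even_or_odd' n with ⟨m, rfl | rfl⟩
  · obtain ⟨j, rfl⟩ : ∃ j, m = j + 1 + 1 := ⟨m - 2, by omega⟩
    obtain ⟨e, he, hd⟩ := exists_sum_comp_dotProduct_self (F := F) hF (j + 1 + 1)
    obtain ⟨u, hu, huv, hχ⟩ := exists_quadraticChar_neg_mul hF hn hγ0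
    obtain ⟨z, hz⟩ := hγ.2 (u + γ y)
    have hzu : γ z - γ y = u := by rw [hz, add_sub_cancel_right]
    obtain ⟨P, hP⟩ := exists_card_mul_tripleCorr_of_not_isotropic hF hd hγ0 hu huv hχ
    rw [← hzu, tripleCorr_map_sub_map hγ h] at hP
    have hq : 2 < (Fintype.card F : ℤ) := by exact_mod_cast two_lt_card_of_ringChar_ne_two hF
    by_cases hort : (z - y) ⬝ᵥ (x - y) = 0
    · obtain ⟨K, hK⟩ := exists_card_mul_tripleCorr_of_orthogonal hF hd hne' hxy hort
      rw [hK] at hP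
      generalize (Fintype.card F : ℤ) = q at *
      have h1 : q ^ (j + 1) * (q * (K - q ^ j + e * P) - e) = 0 := by linear_combination hP
      have h2 : q * (K - q ^ j + e * P) = e := by
        rcases mul_eq_zero.1 h1 with h | h
        · exact absurd h (pow_ne_zero _ (by omega))
        · linarith
      have h3 : q ∣ e := ⟨_, h2.symm⟩
      have h4 := Int.le_of_dvd one_pos (show q ∣ 1 by rcases he with rfl | rfl <;> simpa using h3)
      omega
    · obtain ⟨K, hK⟩ := exists_card_mul_tripleCorr_of_not_orthogonal hF hd hne' hxy hort
      rw [hK] at hP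
      generalize (Fintype.card F : ℤ) = q at *
      have h1 : q ^ (j + 1) * (q * (K - q ^ j + e * P) - 2 * e) = 0 := by linear_combination hP
      have h2 : q * (K - q ^ j + e * P) = 2 * e := by
        rcases mul_eq_zero.1 h1 with h | h
        · exact absurd h (pow_ne_zero _ (by omega))
        · linarith
      have h3 : q ∣ 2 * e := ⟨_, h2.symm⟩
      have h4 := Int.le_of_dvd two_pos (show q ∣ 2 by rcases he with rfl | rfl <;> simpa using h3)
      omega
  · exact card_sq_mul_pairCorr_ne_of_not_isotropic hF hγ0
      (by rw [pairCorr_map_sub_map hγ h, card_sq_mul_pairCorr_of_isotropic hF hne' hxy])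

theorem map_isotropic_iff_of_integral (hF : ringChar F ≠ 2) (hn : 3 ≤ n)
    (hγ : Function.Bijective γ)
    (h : ∀ x y, IsSquare ((x - y) ⬝ᵥ (x - y)) ↔ IsSquare ((γ x - γ y) ⬝ᵥ (γ x - γ y)))
    (x y : Fin n → F) : (γ x - γ y) ⬝ᵥ (γ x - γ y) = 0 ↔ (x - y) ⬝ᵥ (x - y) = 0 := by
  refine ⟨fun hxy => ?_, map_isotropic_of_integral hF hn hγ h⟩
  let e := Equiv.ofBijective γ hγ
  have h1 := map_isotropic_of_integral hF hn e.symm.bijective (fun x y => by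
    rw [h (e.symm x)]
    change _ ↔ IsSquare ((e (e.symm x) - e (e.symm y)) ⬝ᵥ (e (e.symm x) - e (e.symm y)))
    rw [e.apply_symm_apply, e.apply_symm_apply]) (x := e x) (y := e y) hxy
  rwa [e.symm_apply_apply, e.symm_apply_apply] at h1

end Integral

section Isotropic

variable {F : Type*} [Field F] {n : ℕ}

theorem dotProduct_self_sub_smul_eq_zero (h2 : (2 : F) ≠ 0) {x v : Fin n → F} (hv : v ⬝ᵥ v = 0)
    (hxv : x ⬝ᵥ v ≠ 0) :
    (x - (x ⬝ᵥ x / (2 * x ⬝ᵥ v)) • v) ⬝ᵥ (x - (x ⬝ᵥ x / (2 * x ⬝ᵥ v)) • v) = 0 := by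
  rw [dotProduct_self_sub, dotProduct_smul, dotProduct_smul, smul_dotProduct, hv]
  simp only [smul_eq_mul]
  field_simp
  ring

theorem exists_isotropic_dotProduct_eq_one (h2 : (2 : F) ≠ 0) {v : Fin n → F} (hv0 : v ≠ 0)
    (hv : v ⬝ᵥ v = 0) : ∃ f : Fin n → F, f ⬝ᵥ f = 0 ∧ v ⬝ᵥ f = 1 := by
  obtain ⟨u, hu⟩ := exists_dotProduct_eq_one hv0
  refine ⟨_, dotProduct_self_sub_smul_eq_zero h2 hv (hu.trans_ne one_ne_zero), ?_⟩
  rw [dotProduct_sub, dotProduct_smul, hv, smul_zero, sub_zero, dotProduct_comm, hu]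

theorem exists_sq_add_sq_eq [Finite F] (h2 : (2 : F) ≠ 0) (x : F) :
    ∃ a b : F, a ^ 2 + b ^ 2 = x := by
  have := Fintype.ofFinite F
  have hc := FiniteField.odd_card_of_char_ne_two (F := F) fun h => h2 (by
    have := ringChar.Nat.cast_ringChar (R := F)
    rwa [h, Nat.cast_ofNat] at this)
  obtain ⟨a, b, hab⟩ := FiniteField.exists_root_sum_quadratic (R := F) (f := Polynomial.X ^ 2)
    (g := Polynomial.X ^ 2 - Polynomial.C x) (Polynomial.degree_X_pow 2)
    (Polynomial.degree_X_pow_sub_C two_pos x) hc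
  refine ⟨a, b, ?_⟩
  simp only [Polynomial.eval_pow, Polynomial.eval_X, Polynomial.eval_sub, Polynomial.eval_C] at hab
  linear_combination hab

theorem exists_isotropic_ne_zero [Finite F] (h2 : (2 : F) ≠ 0) (hn : 3 ≤ n) :
    ∃ v : Fin n → F, v ≠ 0 ∧ v ⬝ᵥ v = 0 := by
  obtain ⟨a, b, hab⟩ := exists_sq_add_sq_eq h2 (-1)
  let i : Fin n := ⟨0, by omega⟩
  let j : Fin n := ⟨1, by omega⟩
  let k : Fin n := ⟨2, by omega⟩
  have hij : i ≠ j := by simp [i, j]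
  have hik : i ≠ k := by simp [i, k]
  have hjk : j ≠ k := by simp [j, k]
  refine ⟨Pi.single i 1 + Pi.single j a + Pi.single k b, fun h => ?_, ?_⟩
  · have := congrFun h i
    simp [hij, hik] at this
  · simp only [add_dotProduct, single_dotProduct, Pi.add_apply, Pi.single_eq_same,
      Pi.single_eq_of_ne hij, Pi.single_eq_of_ne hik, Pi.single_eq_of_ne hjk,
      Pi.single_eq_of_ne hij.symm, Pi.single_eq_of_ne hik.symm, Pi.single_eq_of_ne hjk.symm]
    linear_combination hab

theorem eq_zero_of_orthogonal_isotropic (h2 : (2 : F) ≠ 0) {v w : Fin n → F} (hv0 : v ≠ 0)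
    (hv : v ⬝ᵥ v = 0) (h : ∀ z : Fin n → F, z ⬝ᵥ z = 0 → z ⬝ᵥ w = 0) : w = 0 := by
  by_contra hw
  obtain ⟨y, hyv, hyw⟩ : ∃ y : Fin n → F, y ⬝ᵥ v ≠ 0 ∧ y ⬝ᵥ w ≠ 0 := by
    obtain ⟨y₁, h₁⟩ := exists_dotProduct_eq_one hv0
    obtain ⟨y₂, h₂⟩ := exists_dotProduct_eq_one hw
    by_cases h₃ : y₁ ⬝ᵥ w = 0
    · by_cases h₄ : y₂ ⬝ᵥ v = 0
      · exact ⟨y₁ + y₂, by simp [add_dotProduct, h₁, h₄], by simp [add_dotProduct, h₂, h₃]⟩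
      · exact ⟨y₂, h₄, by simp [h₂]⟩
    · exact ⟨y₁, by simp [h₁], h₃⟩
  have h1 := h _ (dotProduct_self_sub_smul_eq_zero h2 hv hyv)
  rw [sub_dotProduct, smul_dotProduct, h v hv, smul_zero, sub_zero] at h1
  exact hyw h1

theorem isotropic_induction (h2 : (2 : F) ≠ 0) {v : Fin n → F} (hv0 : v ≠ 0) (hv : v ⬝ᵥ v = 0)
    {P : (Fin n → F) → Prop} (hadd : ∀ x y, P x → P y → P (x + y)) (hsmul : ∀ c : F, P (c • v))
    (hiso : ∀ w, w ⬝ᵥ w = 0 → w ⬝ᵥ v ≠ 0 → P w) (x : Fin n → F) : P x := by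
  have key : ∀ x, x ⬝ᵥ v ≠ 0 → P x := fun x hx => by
    rw [← sub_add_cancel x ((x ⬝ᵥ x / (2 * x ⬝ᵥ v)) • v)]
    refine hadd _ _ (hiso _ (dotProduct_self_sub_smul_eq_zero h2 hv hx) ?_) (hsmul _)
    rwa [sub_dotProduct, smul_dotProduct, hv, smul_zero, sub_zero]
  by_cases hx : x ⬝ᵥ v = 0
  · obtain ⟨f, -, hvf⟩ := exists_isotropic_dotProduct_eq_one h2 hv0 hv
    rw [dotProduct_comm] at hvf
    rw [← add_neg_cancel_right x f]
    exact hadd _ _ (key _ (by simp [add_dotProduct, hx, hvf])) (key _ (by simp [hvf]))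
  · exact key x hx

theorem exists_eq_smul_of_isotropic (h2 : (2 : F) ≠ 0) {d w : Fin n → F} (hd0 : d ≠ 0)
    (hd : d ⬝ᵥ d = 0)
    (h : ∀ z : Fin n → F, z ⬝ᵥ z = 0 → (z - d) ⬝ᵥ (z - d) = 0 → (z - w) ⬝ᵥ (z - w) = 0) :
    ∃ c : F, w = c • d := by
  have hw : w ⬝ᵥ w = 0 := by simpa using h 0 (by simp) (by simpa using hd)
  have hdw : d ⬝ᵥ w = 0 := by
    have := h d hd (by simp)
    rw [dotProduct_self_sub, hd, hw] at this
    exact (mul_eq_zero.1 (by linear_combination -this : (2 : F) * d ⬝ᵥ w = 0)).resolve_left h2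
  refine exists_eq_smul_of_dotProduct hd0 fun u hu => ?_
  by_contra huw
  have hz := dotProduct_self_sub_smul_eq_zero h2 hw huw
  have h1 := h _ hz (by
    rw [dotProduct_self_sub, hz, hd, sub_dotProduct, smul_dotProduct, hu, dotProduct_comm w, hdw]
    simp)
  rw [dotProduct_self_sub, hz, hw, sub_dotProduct, smul_dotProduct, hw] at h1
  exact mul_ne_zero h2 huw (by linear_combination -h1)

end Isotropic

section LightlikeMap

variable {F : Type*} [Field F] {n : ℕ} {γ : (Fin n → F) ≃ (Fin n → F)}

theorem symm_isotropic_iff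
    (hγ : ∀ x y, (γ x - γ y) ⬝ᵥ (γ x - γ y) = 0 ↔ (x - y) ⬝ᵥ (x - y) = 0) (x y : Fin n → F) :
    (γ.symm x - γ.symm y) ⬝ᵥ (γ.symm x - γ.symm y) = 0 ↔ (x - y) ⬝ᵥ (x - y) = 0 := by
  simpa using (hγ (γ.symm x) (γ.symm y)).symm

theorem map_add_sub_isotropic
    (hγ : ∀ x y, (γ x - γ y) ⬝ᵥ (γ x - γ y) = 0 ↔ (x - y) ⬝ᵥ (x - y) = 0) {d : Fin n → F}
    (hd : d ⬝ᵥ d = 0) (x : Fin n → F) :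
    (γ (x + d) - γ x) ⬝ᵥ (γ (x + d) - γ x) = 0 := by
  rw [hγ]; simpa using hd

theorem map_add_sub_ne_zero {d : Fin n → F} (hd : d ≠ 0) (x : Fin n → F) :
    γ (x + d) - γ x ≠ 0 := by
  rw [sub_ne_zero, γ.injective.ne_iff]; simpa using hd

theorem exists_map_add_smul_sub (h2 : (2 : F) ≠ 0)
    (hγ : ∀ x y, (γ x - γ y) ⬝ᵥ (γ x - γ y) = 0 ↔ (x - y) ⬝ᵥ (x - y) = 0) {d : Fin n → F}
    (hd0 : d ≠ 0) (hd : d ⬝ᵥ d = 0) (x : Fin n → F) (t : F) :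
    ∃ c : F, γ (x + t • d) - γ x = c • (γ (x + d) - γ x) := by
  refine exists_eq_smul_of_isotropic h2 (map_add_sub_ne_zero hd0 x)
    (map_add_sub_isotropic hγ hd x) fun z hz hzd => ?_
  obtain ⟨z, rfl⟩ : ∃ z', z = γ z' - γ x := ⟨γ.symm (z + γ x), by simp⟩
  rw [sub_sub_sub_cancel_right] at hzd ⊢
  rw [hγ] at hz hzd ⊢
  rw [← sub_sub, dotProduct_self_sub, hz, hd] at hzd
  rw [← sub_sub, dotProduct_self_sub, hz, dotProduct_smul, dotProduct_smul, smul_dotProduct, hd]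
  simp only [smul_eq_mul]
  linear_combination t * hzd

theorem exists_map_add_smul_eq (h2 : (2 : F) ≠ 0)
    (hγ : ∀ x y, (γ x - γ y) ⬝ᵥ (γ x - γ y) = 0 ↔ (x - y) ⬝ᵥ (x - y) = 0) {d : Fin n → F}
    (hd0 : d ≠ 0) (hd : d ⬝ᵥ d = 0) (x : Fin n → F) (t : F) :
    ∃ c : F, γ (x + c • d) = γ x + t • (γ (x + d) - γ x) := by
  obtain ⟨c, hc⟩ := exists_map_add_smul_sub h2 (symm_isotropic_iff hγ) (map_add_sub_ne_zero hd0 x)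
    (map_add_sub_isotropic hγ hd x) (γ x) t
  refine ⟨c, ?_⟩
  rw [add_sub_cancel, γ.symm_apply_apply, γ.symm_apply_apply, add_sub_cancel_left] at hc
  rw [← hc, add_sub_cancel, γ.apply_symm_apply]

theorem map_orthogonal (h2 : (2 : F) ≠ 0)
    (hγ : ∀ x y, (γ x - γ y) ⬝ᵥ (γ x - γ y) = 0 ↔ (x - y) ⬝ᵥ (x - y) = 0) {d : Fin n → F}
    (hd0 : d ≠ 0) (hd : d ⬝ᵥ d = 0) {x z : Fin n → F} (h : (z - x) ⬝ᵥ d = 0) :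
    (γ z - γ x) ⬝ᵥ (γ (x + d) - γ x) = 0 := by
  by_contra hne
  have hd' := map_add_sub_isotropic hγ hd x
  have hconst : ∀ c : F, (z - (x + c • d)) ⬝ᵥ (z - (x + c • d)) = (z - x) ⬝ᵥ (z - x) := fun c => by
    rw [← sub_sub, dotProduct_self_sub, dotProduct_smul, dotProduct_smul, smul_dotProduct, hd, h]
    simp
  have h0 := dotProduct_self_sub_smul_eq_zero h2 hd' hne
  set t := (γ z - γ x) ⬝ᵥ (γ z - γ x) / (2 * (γ z - γ x) ⬝ᵥ (γ (x + d) - γ x))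
  obtain ⟨c₁, hc₁⟩ := exists_map_add_smul_eq h2 hγ hd0 hd x t
  obtain ⟨c₂, hc₂⟩ := exists_map_add_smul_eq h2 hγ hd0 hd x (t + 1)
  have h1 := (hγ z (x + c₂ • d)).2 (by
    rw [hconst, ← hconst c₁, ← hγ, hc₁, ← sub_sub]; exact h0)
  rw [hc₂, ← sub_sub, add_smul, one_smul, ← sub_sub, dotProduct_self_sub, h0, hd', sub_dotProduct,
    smul_dotProduct, hd'] at h1
  exact mul_ne_zero h2 hne (by linear_combination -h1)

theorem map_orthogonal_iff (h2 : (2 : F) ≠ 0)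
    (hγ : ∀ x y, (γ x - γ y) ⬝ᵥ (γ x - γ y) = 0 ↔ (x - y) ⬝ᵥ (x - y) = 0) {d : Fin n → F}
    (hd0 : d ≠ 0) (hd : d ⬝ᵥ d = 0) (x z : Fin n → F) :
    (γ z - γ x) ⬝ᵥ (γ (x + d) - γ x) = 0 ↔ (z - x) ⬝ᵥ d = 0 := by
  refine ⟨fun h => ?_, map_orthogonal h2 hγ hd0 hd⟩
  simpa using map_orthogonal h2 (symm_isotropic_iff hγ) (map_add_sub_ne_zero hd0 x)
    (map_add_sub_isotropic hγ hd x) h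

theorem map_ne_zero_of_map_zero (h0 : γ 0 = 0) {v : Fin n → F} (hv : v ≠ 0) : γ v ≠ 0 := by
  rwa [← h0, γ.injective.ne_iff]

theorem exists_map_add_sub_eq_smul (h2 : (2 : F) ≠ 0)
    (hγ : ∀ x y, (γ x - γ y) ⬝ᵥ (γ x - γ y) = 0 ↔ (x - y) ⬝ᵥ (x - y) = 0) (h0 : γ 0 = 0)
    {v : Fin n → F} (hv0 : v ≠ 0) (hv : v ⬝ᵥ v = 0) (a : Fin n → F) :
    ∃ c : F, γ (a + v) - γ a = c • γ v := by
  have hO : ∀ z, γ z ⬝ᵥ γ v = 0 ↔ z ⬝ᵥ v = 0 := fun z => by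
    simpa [h0] using map_orthogonal_iff h2 hγ hv0 hv 0 z
  have hOa := map_orthogonal_iff h2 hγ hv0 hv a
  refine exists_eq_smul_of_dotProduct (map_ne_zero_of_map_zero h0 hv0) fun u hu => ?_
  by_cases hav : a ⬝ᵥ v = 0
  · obtain ⟨z, rfl⟩ := γ.surjective u
    have h1 := (hOa 0).2 (by simpa using hav)
    have h3 := (hOa z).2 (by rw [sub_dotProduct, (hO z).1 hu, hav, sub_zero])
    rw [h0, zero_sub, neg_dotProduct] at h1
    rw [sub_dotProduct] at h3
    linear_combination h3 - h1
  · by_contra hne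
    obtain ⟨z, hz⟩ := γ.surjective ((γ a ⬝ᵥ (γ (a + v) - γ a) / u ⬝ᵥ (γ (a + v) - γ a)) • u)
    have h1 := (hO z).1 (by rw [hz, smul_dotProduct, hu, smul_zero])
    have h3 := (hOa z).1 (by
      rw [hz, sub_dotProduct, smul_dotProduct, smul_eq_mul, div_mul_cancel₀ _ hne, sub_self])
    rw [sub_dotProduct, h1, zero_sub, neg_eq_zero] at h3
    exact hav h3

theorem map_dotProduct_eq_iff (h2 : (2 : F) ≠ 0)
    (hγ : ∀ x y, (γ x - γ y) ⬝ᵥ (γ x - γ y) = 0 ↔ (x - y) ⬝ᵥ (x - y) = 0) (h0 : γ 0 = 0)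
    {v : Fin n → F} (hv : v ⬝ᵥ v = 0) (x y : Fin n → F) :
    γ x ⬝ᵥ γ v = γ y ⬝ᵥ γ v ↔ x ⬝ᵥ v = y ⬝ᵥ v := by
  rcases eq_or_ne v 0 with rfl | hv0
  · simp [h0]
  obtain ⟨c, hc⟩ := exists_map_add_sub_eq_smul h2 hγ h0 hv0 hv y
  have hc0 : c ≠ 0 := by
    rintro rfl
    exact map_add_sub_ne_zero (γ := γ) hv0 y (by rw [hc, zero_smul])
  have h := map_orthogonal_iff h2 hγ hv0 hv y x
  rwa [hc, dotProduct_smul, smul_eq_mul, mul_eq_zero, or_iff_right hc0, sub_dotProduct,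
    sub_dotProduct, sub_eq_zero, sub_eq_zero] at h

theorem map_dotProduct_eq_zero_iff (h2 : (2 : F) ≠ 0)
    (hγ : ∀ x y, (γ x - γ y) ⬝ᵥ (γ x - γ y) = 0 ↔ (x - y) ⬝ᵥ (x - y) = 0) (h0 : γ 0 = 0)
    {v : Fin n → F} (hv : v ⬝ᵥ v = 0) (x : Fin n → F) : γ x ⬝ᵥ γ v = 0 ↔ x ⬝ᵥ v = 0 := by
  simpa [h0] using map_dotProduct_eq_iff h2 hγ h0 hv x 0

theorem map_add_dotProduct (h2 : (2 : F) ≠ 0) (hn : 3 ≤ n)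
    (hγ : ∀ x y, (γ x - γ y) ⬝ᵥ (γ x - γ y) = 0 ↔ (x - y) ⬝ᵥ (x - y) = 0) (h0 : γ 0 = 0)
    {v : Fin n → F} (hv0 : v ≠ 0) (hv : v ⬝ᵥ v = 0) (x y : Fin n → F) :
    γ (x + y) ⬝ᵥ γ v = γ x ⬝ᵥ γ v + γ y ⬝ᵥ γ v := by
  obtain ⟨f, hf, hvf⟩ := exists_isotropic_dotProduct_eq_one h2 hv0 hv
  obtain ⟨u, huv, huf, hu⟩ := exists_not_isotropic_orthogonal_hyperbolic h2 hn hv hf hvf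
  have hfv : f ⬝ᵥ v = 1 := by rw [dotProduct_comm, hvf]
  have hvu : v ⬝ᵥ u = 0 := by rw [dotProduct_comm, huv]
  have hfu : f ⬝ᵥ u = 0 := by rw [dotProduct_comm, huf]
  have hO {z} (hz : z ⬝ᵥ z = 0) := map_dotProduct_eq_iff h2 hγ h0 hz
  have hO0 {z} (hz : z ⬝ᵥ z = 0) := map_dotProduct_eq_zero_iff h2 hγ h0 hz
  set k := u ⬝ᵥ u with hk
  set v₁ := v - (k / 2) • f + u with hv₁
  set v₂ := v - (k / 2) • f - u with hv₂
  have h₁ : v₁ ⬝ᵥ v₁ = 0 := by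
    simp only [hv₁, add_dotProduct, sub_dotProduct, smul_dotProduct, dotProduct_add, dotProduct_sub,
      dotProduct_smul, smul_eq_mul, hv, hf, hvf, hfv, hvu, hfu, huv, huf, ← hk]
    field_simp; ring
  have h₂ : v₂ ⬝ᵥ v₂ = 0 := by
    simp only [hv₂, sub_dotProduct, smul_dotProduct, dotProduct_sub,
      dotProduct_smul, smul_eq_mul, hv, hf, hvf, hfv, hvu, hfu, huv, huf, ← hk]
    field_simp; ring
  set x₁ := (x ⬝ᵥ v) • f + (x ⬝ᵥ v / k) • u with hx₁
  set x₂ := (y ⬝ᵥ v) • f - (y ⬝ᵥ v / k) • u with hx₂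
  have e₁ : x₁ ⬝ᵥ v = x ⬝ᵥ v := by simp [hx₁, add_dotProduct, smul_dotProduct, hfv, huv]
  have e₂ : x₂ ⬝ᵥ v = y ⬝ᵥ v := by simp [hx₂, sub_dotProduct, smul_dotProduct, hfv, huv]
  have e₃ : x₁ ⬝ᵥ f = 0 := by simp [hx₁, add_dotProduct, smul_dotProduct, hf, huf]
  have e₄ : x₂ ⬝ᵥ f = 0 := by simp [hx₂, sub_dotProduct, smul_dotProduct, hf, huf]
  have e₅ : x₁ ⬝ᵥ v₂ = 0 := by
    rw [hv₂, dotProduct_sub, dotProduct_sub, dotProduct_smul, e₃, e₁]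
    simp [hx₁, add_dotProduct, smul_dotProduct, hfu, ← hk, hu]
  have e₆ : x₂ ⬝ᵥ v₁ = 0 := by
    rw [hv₁, dotProduct_add, dotProduct_sub, dotProduct_smul, e₄, e₂]
    simp [hx₂, sub_dotProduct, smul_dotProduct, hfu, ← hk, hu]
  obtain ⟨w, hw⟩ := γ.surjective (γ (x₁ + x₂) - γ x₁ - γ x₂)
  have w₁ : w ⬝ᵥ v₁ = 0 := by
    rw [← hO0 h₁, hw, sub_dotProduct, sub_dotProduct, (hO0 h₁ x₂).2 e₆,
      (hO h₁ (x₁ + x₂) x₁).2 (by rw [add_dotProduct, e₆, add_zero]), sub_self, sub_zero]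
  have w₂ : w ⬝ᵥ v₂ = 0 := by
    rw [← hO0 h₂, hw, sub_dotProduct, sub_dotProduct, (hO0 h₂ x₁).2 e₅,
      (hO h₂ (x₁ + x₂) x₂).2 (by rw [add_dotProduct, e₅, zero_add]), sub_zero, sub_self]
  have w₃ : w ⬝ᵥ f = 0 := by
    rw [← hO0 hf, hw, sub_dotProduct, sub_dotProduct, (hO0 hf x₁).2 e₃, (hO0 hf x₂).2 e₄,
      (hO0 hf (x₁ + x₂)).2 (by rw [add_dotProduct, e₃, e₄, add_zero]), sub_zero, sub_zero]
  have w₄ : w ⬝ᵥ v = 0 := by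
    rw [hv₁, dotProduct_add, dotProduct_sub, dotProduct_smul, w₃] at w₁
    rw [hv₂, dotProduct_sub, dotProduct_sub, dotProduct_smul, w₃] at w₂
    exact (mul_eq_zero.1 (by linear_combination w₁ + w₂ : (2 : F) * w ⬝ᵥ v = 0)).resolve_left h2
  rw [← hO0 hv, hw, sub_dotProduct, sub_dotProduct, (hO hv _ _).2 e₁, (hO hv _ _).2 e₂,
    (hO hv (x₁ + x₂) (x + y)).2 (by rw [add_dotProduct x₁, add_dotProduct x, e₁, e₂])] at w₄
  linear_combination w₄

theorem map_add_of_isotropic [Finite F] (h2 : (2 : F) ≠ 0) (hn : 3 ≤ n)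
    (hγ : ∀ x y, (γ x - γ y) ⬝ᵥ (γ x - γ y) = 0 ↔ (x - y) ⬝ᵥ (x - y) = 0) (h0 : γ 0 = 0)
    (x y : Fin n → F) : γ (x + y) = γ x + γ y := by
  obtain ⟨v₀, hv₀, hv₀'⟩ := exists_isotropic_ne_zero h2 hn
  rw [← sub_eq_zero]
  refine eq_zero_of_orthogonal_isotropic h2 hv₀ hv₀' fun z hz => ?_
  obtain ⟨v, rfl⟩ := γ.surjective z
  rcases eq_or_ne v 0 with rfl | hv0
  · rw [h0, zero_dotProduct]
  have hv : v ⬝ᵥ v = 0 := by simpa [h0, hz] using (hγ v 0).symm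
  rw [dotProduct_comm, sub_dotProduct, add_dotProduct, map_add_dotProduct h2 hn hγ h0 hv0 hv,
    sub_self]

end LightlikeMap

section Semilinear

variable {F : Type*} [Field F] {n : ℕ} {γ : (Fin n → F) ≃ (Fin n → F)}

theorem exists_map_smul_eq (h2 : (2 : F) ≠ 0)
    (hγ : ∀ x y, (γ x - γ y) ⬝ᵥ (γ x - γ y) = 0 ↔ (x - y) ⬝ᵥ (x - y) = 0) (h0 : γ 0 = 0)
    {v : Fin n → F} (hv : v ⬝ᵥ v = 0) (t : F) : ∃ c : F, γ (t • v) = c • γ v := by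
  rcases eq_or_ne v 0 with rfl | hv0
  · exact ⟨0, by simp [h0]⟩
  · simpa [h0] using exists_map_add_smul_sub h2 hγ hv0 hv 0 t

/-- For a hyperbolic pair `v`, `f`, the scalings along the two isotropic lines are related through
isotropic vectors outside their span. -/
theorem scaling_relations (h2 : (2 : F) ≠ 0)
    (hγ : ∀ x y, (γ x - γ y) ⬝ᵥ (γ x - γ y) = 0 ↔ (x - y) ⬝ᵥ (x - y) = 0) (h0 : γ 0 = 0)
    {v f u : Fin n → F} (hv : v ⬝ᵥ v = 0) (hf : f ⬝ᵥ f = 0) (hvf : v ⬝ᵥ f = 1)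
    (huv : u ⬝ᵥ v = 0) (huf : u ⬝ᵥ f = 0) {σ τ : F → F} (hσ : ∀ t, γ (t • v) = σ t • γ v)
    (hτ : ∀ t, γ (t • f) = τ t • γ f) {x y c : F} (hxy : 2 * (x * y) + c ^ 2 * u ⬝ᵥ u = 0) (t : F) :
    ∃ s, σ (t * x) = s * σ x ∧ τ (t * y) = s * τ y := by
  have hfv : f ⬝ᵥ v = 1 := by rw [dotProduct_comm, hvf]
  have hvu : v ⬝ᵥ u = 0 := by rw [dotProduct_comm, huv]
  have hfu : f ⬝ᵥ u = 0 := by rw [dotProduct_comm, huf]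
  have hne : γ v ⬝ᵥ γ f ≠ 0 := by
    rw [Ne, map_dotProduct_eq_zero_iff h2 hγ h0 hf, hvf]; exact one_ne_zero
  have hne' : γ f ⬝ᵥ γ v ≠ 0 := by rwa [dotProduct_comm]
  set z := x • v + y • f + c • u with hz
  have hzz : z ⬝ᵥ z = 0 := by
    simp only [hz, add_dotProduct, smul_dotProduct, dotProduct_add,
      dotProduct_smul, smul_eq_mul, hv, hf, hvf, hfv, hvu, hfu, huv, huf]
    linear_combination hxy
  have hzf : z ⬝ᵥ f = x := by simp [hz, add_dotProduct, smul_dotProduct, hf, hvf, huf]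
  have hzv : z ⬝ᵥ v = y := by simp [hz, add_dotProduct, smul_dotProduct, hv, hfv, huv]
  obtain ⟨s, hs⟩ := exists_map_smul_eq h2 hγ h0 hzz t
  have key₁ : ∀ t, γ (t • z) ⬝ᵥ γ f = σ (t * x) * γ v ⬝ᵥ γ f := fun t => by
    rw [← smul_eq_mul, ← smul_dotProduct, ← hσ, map_dotProduct_eq_iff h2 hγ h0 hf]
    simp [smul_dotProduct, hzf, hvf]
  have key₂ : ∀ t, γ (t • z) ⬝ᵥ γ v = τ (t * y) * γ f ⬝ᵥ γ v := fun t => by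
    rw [← smul_eq_mul, ← smul_dotProduct, ← hτ, map_dotProduct_eq_iff h2 hγ h0 hv]
    simp [smul_dotProduct, hzv, hfv]
  refine ⟨s, mul_right_cancel₀ hne ?_, mul_right_cancel₀ hne' ?_⟩
  · have := key₁ 1
    rw [one_smul, one_mul] at this
    rw [← key₁, hs, smul_dotProduct, smul_eq_mul, this, mul_assoc]
  · have := key₂ 1
    rw [one_smul, one_mul] at this
    rw [← key₂, hs, smul_dotProduct, smul_eq_mul, this, mul_assoc]

theorem map_mul_of_map_mul_sq [Finite F] (h2 : (2 : F) ≠ 0) {σ : F → F}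
    (hadd : ∀ s t, σ (s + t) = σ s + σ t) (hsq : ∀ t c, σ (t * c ^ 2) = σ t * σ (c ^ 2)) (s t : F) :
    σ (s * t) = σ s * σ t := by
  obtain ⟨a, b, rfl⟩ := exists_sq_add_sq_eq h2 t
  rw [mul_add, hadd, hadd, hsq, hsq, mul_add]

theorem exists_ringHom_of_hyperbolic [Finite F] (h2 : (2 : F) ≠ 0) (hn : 3 ≤ n)
    (hγ : ∀ x y, (γ x - γ y) ⬝ᵥ (γ x - γ y) = 0 ↔ (x - y) ⬝ᵥ (x - y) = 0) (h0 : γ 0 = 0)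
    {v f : Fin n → F} (hv : v ⬝ᵥ v = 0) (hf : f ⬝ᵥ f = 0) (hvf : v ⬝ᵥ f = 1) :
    ∃ σ : F →+* F, (∀ t, γ (t • v) = σ t • γ v) ∧ ∀ t, γ (t • f) = σ t • γ f := by
  obtain ⟨u, huv, huf, hu⟩ := exists_not_isotropic_orthogonal_hyperbolic h2 hn hv hf hvf
  have hv0 : v ≠ 0 := by rintro rfl; simp at hvf
  have hf0 : f ≠ 0 := by rintro rfl; simp at hvf
  have hfv : f ⬝ᵥ v = 1 := by rw [dotProduct_comm, hvf]
  have hadd := map_add_of_isotropic h2 hn hγ h0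
  have facts : ∀ {v : Fin n → F}, v ≠ 0 → ∀ σ : F → F, (∀ t, γ (t • v) = σ t • γ v) →
      (∀ s t, σ (s + t) = σ s + σ t) ∧ σ 0 = 0 ∧ σ 1 = 1 := fun {v} hv0 σ hσ => by
    have inj := smul_left_injective F (map_ne_zero_of_map_zero h0 hv0)
    refine ⟨fun s t => inj ?_, inj ?_, inj ?_⟩
    · simp only [add_smul]
      rw [← hσ s, ← hσ t, ← hadd, ← add_smul, hσ]
    · simp only [zero_smul]
      rw [← hσ, zero_smul, h0]
    · simp only [one_smul]
      rw [← hσ, one_smul]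
  choose σ hσ using exists_map_smul_eq h2 hγ h0 hv
  choose τ hτ using exists_map_smul_eq h2 hγ h0 hf
  obtain ⟨hσa, hσ0, hσ1⟩ := facts hv0 σ hσ
  obtain ⟨hτa, hτ0, hτ1⟩ := facts hf0 τ hτ
  have rel := @scaling_relations _ _ _ _ h2 hγ h0 _ _ _ hv hf hvf huv huf _ _ hσ hτ
  set κ := -(u ⬝ᵥ u) / 2 with hκ
  have hκ0 : κ ≠ 0 := div_ne_zero (neg_ne_zero.2 hu) h2
  have hτκ : τ κ ≠ 0 := fun h => by
    refine map_ne_zero_of_map_zero h0 (smul_ne_zero hκ0 hf0) ?_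
    rw [hτ, h, zero_smul]
  have hστ : ∀ t, τ (t * κ) = σ t * τ κ := fun t => by
    obtain ⟨s, hs, hs'⟩ := @rel 1 κ 1 (by rw [hκ]; field_simp; ring) t
    rw [mul_one, hσ1, mul_one] at hs
    rw [hs', hs]
  have hσm := map_mul_of_map_mul_sq h2 hσa fun t c => by
    obtain ⟨s, hs, hs'⟩ := @rel (c ^ 2) κ c (by rw [hκ]; field_simp; ring) t
    rw [hστ] at hs'
    rw [hs, mul_right_cancel₀ hτκ hs']
  have hτσ : ∀ t, τ t = σ t := fun t => by
    have h1 := hστ (t * κ⁻¹)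
    have h3 := hστ κ⁻¹
    rw [inv_mul_cancel₀ hκ0, hτ1] at h3
    rw [inv_mul_cancel_right₀ hκ0, hσm, mul_assoc, ← h3, mul_one] at h1
    exact h1
  exact ⟨⟨⟨⟨σ, hσ1⟩, hσm⟩, hσ0, hσa⟩, hσ, fun t => by rw [hτ, hτσ]; rfl⟩

theorem exists_semisimilarity [Finite F] (h2 : (2 : F) ≠ 0) (hn : 3 ≤ n)
    (hγ : ∀ x y, (γ x - γ y) ⬝ᵥ (γ x - γ y) = 0 ↔ (x - y) ⬝ᵥ (x - y) = 0) (h0 : γ 0 = 0) :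
    ∃ (σ : F →+* F) (μ : F), (∀ x y, γ (x + y) = γ x + γ y) ∧ (∀ (t : F) x, γ (t • x) = σ t • γ x) ∧
      ∀ x y, γ x ⬝ᵥ γ y = μ * σ (x ⬝ᵥ y) := by
  have hadd := map_add_of_isotropic h2 hn hγ h0
  obtain ⟨v, hv0, hv⟩ := exists_isotropic_ne_zero (F := F) h2 hn
  obtain ⟨f, hf, hvf⟩ := exists_isotropic_dotProduct_eq_one h2 hv0 hv
  obtain ⟨σ, hσv, -⟩ := exists_ringHom_of_hyperbolic h2 hn hγ h0 hv hf hvf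
  have hσ : ∀ x, ∀ t : F, γ (t • x) = σ t • γ x := by
    refine isotropic_induction h2 hv0 hv (fun x y hx hy t => ?_) (fun c t => ?_)
      fun w hw hwv t => ?_
    · rw [smul_add, hadd, hx, hy, hadd, smul_add]
    · rw [smul_smul, hσv, hσv, map_mul, smul_smul]
    · obtain ⟨σ', hσ', hσw⟩ := exists_ringHom_of_hyperbolic h2 hn hγ h0 hv
        (f := (w ⬝ᵥ v)⁻¹ • w) (by simp [hw]) (by
          rw [dotProduct_smul, dotProduct_comm v w, smul_eq_mul, inv_mul_cancel₀ hwv])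
      obtain rfl : σ' = σ := by
        ext s
        exact smul_left_injective F (map_ne_zero_of_map_zero h0 hv0) ((hσ' s).symm.trans (hσv s))
      have key : ∀ s, γ (s • w) = σ' (s * w ⬝ᵥ v) • γ ((w ⬝ᵥ v)⁻¹ • w) := fun s => by
        rw [← hσw, smul_smul, mul_inv_cancel_right₀ hwv]
      have h1 := key 1
      rw [one_smul, one_mul] at h1
      rw [key t, h1, map_mul, smul_smul]
  have pairing : ∀ {v f : Fin n → F}, v ⬝ᵥ v = 0 → f ⬝ᵥ v = 1 → ∀ x,
      γ x ⬝ᵥ γ v = σ (x ⬝ᵥ v) * γ f ⬝ᵥ γ v := fun {v f} hv hfv x => by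
    rw [← smul_eq_mul, ← smul_dotProduct, ← hσ, map_dotProduct_eq_iff h2 hγ h0 hv,
      smul_dotProduct, hfv, smul_eq_mul, mul_one]
  have hfv : f ⬝ᵥ v = 1 := by rw [dotProduct_comm, hvf]
  refine ⟨σ, γ f ⬝ᵥ γ v, hadd, fun t x => hσ x t, fun x y => ?_⟩
  revert x
  refine isotropic_induction (P := fun y => ∀ x, γ x ⬝ᵥ γ y = γ f ⬝ᵥ γ v * σ (x ⬝ᵥ y)) h2 hv0 hv
    (fun y y' hy hy' x => ?_) (fun c x => ?_) (fun w hw hwv x => ?_) y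
  · rw [hadd, dotProduct_add, hy, hy', dotProduct_add, map_add, mul_add]
  · rw [hσ, dotProduct_smul, pairing hv hfv, dotProduct_smul, smul_eq_mul, smul_eq_mul, map_mul]
    ring
  · have hg : ((w ⬝ᵥ v)⁻¹ • v) ⬝ᵥ w = 1 := by
      rw [smul_dotProduct, dotProduct_comm v w, smul_eq_mul, inv_mul_cancel₀ hwv]
    have h1 := pairing hw hg v
    rw [dotProduct_comm, pairing hv hfv w, dotProduct_comm v w] at h1
    rw [pairing hw hg, ← mul_left_cancel₀ ((map_ne_zero σ).2 hwv) h1, mul_comm]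

end Semilinear

section Similarity

theorem exists_eq_frobenius_pow {F : Type*} [Field F] [Fintype F] {p h : ℕ} [Fact p.Prime]
    (hF : Fintype.card F = p ^ h) (σ : F →+* F) : ∃ i < h, ∀ x, σ x = x ^ p ^ i := by
  have := charP_of_card_eq_prime_pow hF
  let _ := ZMod.algebra F p
  have hfin : Module.finrank (ZMod p) F = h := by
    have := Module.card_eq_pow_finrank (K := ZMod p) (V := F)
    rw [hF, ZMod.card] at this
    exact (Nat.pow_right_injective (Fact.out : p.Prime).two_le this).symm
  obtain ⟨i, hi⟩ := (FiniteField.bijective_frobeniusAlgHom_pow (ZMod p) F).surjective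
    { σ with
      commutes' := fun r => RingHom.congr_fun
        (Subsingleton.elim (σ.comp (algebraMap (ZMod p) F)) (algebraMap (ZMod p) F)) r }
  refine ⟨i, hfin ▸ i.2, fun x => ?_⟩
  have h1 := DFunLike.congr_fun hi x
  simp only [AlgHom.coe_pow, FiniteField.coe_frobeniusAlgHom, pow_iterate, ZMod.card] at h1
  exact h1.symm

variable {F : Type*} [Field F] {n : ℕ}

theorem isSquare_pow_iff_of_odd {m : ℕ} (hm : Odd m) (t : F) : IsSquare (t ^ m) ↔ IsSquare t := by
  refine ⟨fun h => ?_, fun h => h.pow m⟩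
  obtain ⟨k, rfl⟩ := hm
  rcases eq_or_ne t 0 with rfl | ht
  · exact IsSquare.zero
  · have h1 := h.div ⟨t ^ k, rfl⟩
    rwa [pow_succ, pow_mul, ← pow_two, ← pow_mul, ← pow_mul, mul_comm k,
      mul_div_cancel_left₀ _ (pow_ne_zero _ ht)] at h1

theorem vecMul_dotProduct_vecMul {A : Matrix (Fin n) (Fin n) F} (hA : A * A.transpose = 1)
    (x y : Fin n → F) : Matrix.vecMul x A ⬝ᵥ Matrix.vecMul y A = x ⬝ᵥ y := by
  rw [← Matrix.dotProduct_mulVec, ← Matrix.mulVec_transpose, Matrix.mulVec_mulVec, hA,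
    Matrix.one_mulVec]

theorem isSquare_dotProduct_self_semiaffine_iff {p i : ℕ} [Fact p.Prime] [CharP F p] (hp : Odd p)
    {a : F} (ha : a ≠ 0) {A : Matrix (Fin n) (Fin n) F} (hA : A * A.transpose = 1)
    {b : Fin n → F} {γ : (Fin n → F) → (Fin n → F)}
    (hγ : ∀ x, γ x = a • Matrix.vecMul (fun k => x k ^ p ^ i) A + b) (x y : Fin n → F) :
    IsSquare ((γ x - γ y) ⬝ᵥ (γ x - γ y)) ↔ IsSquare ((x - y) ⬝ᵥ (x - y)) := by
  have h1 : γ x - γ y = a • Matrix.vecMul (fun k => (x - y) k ^ p ^ i) A := by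
    rw [hγ, hγ, add_sub_add_right_eq_sub, ← smul_sub, ← Matrix.sub_vecMul]
    congr 2
    ext k
    exact (sub_pow_char_pow (x k) (y k) i).symm
  have h2 : (γ x - γ y) ⬝ᵥ (γ x - γ y) = a ^ 2 * ((x - y) ⬝ᵥ (x - y)) ^ p ^ i := by
    rw [h1, smul_dotProduct, dotProduct_smul, vecMul_dotProduct_vecMul hA, smul_eq_mul,
      smul_eq_mul, ← mul_assoc, ← pow_two, dotProduct, dotProduct, sum_pow_char_pow]
    simp only [mul_pow]
  rw [h2, ← isSquare_pow_iff_of_odd (hp.pow (n := i)) ((x - y) ⬝ᵥ (x - y))]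
  refine ⟨fun h => ?_, fun h => (IsSquare.sq a).mul h⟩
  simpa [ha] using h.div (IsSquare.sq a)

theorem exists_semiaffine_of_integral [Fintype F] (hF : ringChar F ≠ 2) (hn : 3 ≤ n)
    {γ : (Fin n → F) → (Fin n → F)} (hγ : Function.Bijective γ)
    (h : ∀ x y, IsSquare ((x - y) ⬝ᵥ (x - y)) ↔ IsSquare ((γ x - γ y) ⬝ᵥ (γ x - γ y))) :
    ∃ (σ : F →+* F) (a : F) (A : Matrix (Fin n) (Fin n) F), a ≠ 0 ∧ A * A.transpose = 1 ∧
      ∀ x, γ x = a • Matrix.vecMul (fun k => σ (x k)) A + γ 0 := by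
  have h2 := Ring.two_ne_zero hF
  let g : (Fin n → F) ≃ (Fin n → F) := (Equiv.ofBijective γ hγ).trans (Equiv.subRight (γ 0))
  have hg : ∀ x, g x = γ x - γ 0 := fun x => rfl
  obtain ⟨σ, μ, hadd, hsmul, hμ⟩ := exists_semisimilarity (γ := g) h2 hn
    (fun x y => by
      rw [hg, hg, sub_sub_sub_cancel_right]
      exact map_isotropic_iff_of_integral hF hn hγ h x y) (by rw [hg, sub_self])
  let e : Fin n → Fin n → F := fun i => Pi.single i 1
  have hee : ∀ i j, e i ⬝ᵥ e j = (1 : Matrix (Fin n) (Fin n) F) i j := fun i j => by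
    simp [e, Matrix.one_apply, Pi.single_apply, eq_comm]
  let i₀ : Fin n := ⟨0, by omega⟩
  have hμ' : g (e i₀) ⬝ᵥ g (e i₀) = μ := by
    rw [hμ, hee, Matrix.one_apply_eq, map_one, mul_one]
  obtain ⟨a, ha⟩ : IsSquare μ := by
    rw [← hμ', hg, ← h, sub_zero, hee, Matrix.one_apply_eq]
    exact IsSquare.one
  have ha0 : a ≠ 0 := by
    rintro rfl
    have h3 := map_isotropic_iff_of_integral hF hn hγ h (e i₀) 0
    rw [← hg, hμ', sub_zero, hee, Matrix.one_apply_eq] at h3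
    exact one_ne_zero (h3.1 (by simpa using ha))
  let L : (Fin n → F) →+ (Fin n → F) := AddMonoidHom.mk' g hadd
  refine ⟨σ, a, Matrix.of fun i => a⁻¹ • g (e i), ha0, ?_, fun x => ?_⟩
  · ext i j
    have : (Matrix.of (fun i => a⁻¹ • g (e i)) * (Matrix.of fun i => a⁻¹ • g (e i)).transpose) i j =
      (a⁻¹ • g (e i)) ⬝ᵥ (a⁻¹ • g (e j)) := rfl
    rw [this, smul_dotProduct, dotProduct_smul, hμ, hee, ha, smul_eq_mul, smul_eq_mul,
      Matrix.one_apply]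
    split_ifs
    · rw [map_one]; field_simp
    · rw [map_zero]; simp
  · rw [← sub_eq_iff_eq_add, ← hg]
    have hx : x = ∑ i, x i • e i := by
      ext j
      simp [e, Finset.sum_apply, Pi.single_apply]
    have h3 : g x = ∑ i, σ (x i) • g (e i) := by
      conv_lhs => rw [hx]
      change L _ = _
      rw [map_sum]
      exact Finset.sum_congr rfl fun i _ => hsmul _ _
    rw [h3, Matrix.vecMul_eq_sum, Finset.smul_sum]
    refine Finset.sum_congr rfl fun i _ => ?_
    change _ = a • σ (x i) • a⁻¹ • g (e i)
    rw [smul_comm (σ (x i)), smul_inv_smul₀ ha0]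

end Similarity

/-- Let `p` be an odd prime, `q = p^h`, `n ≥ 3`. A bijection
`γ : 𝔽_q^n → 𝔽_q^n` is an integral automorphism of `AG(n,q)` if and only if
there are `a ∈ 𝔽_q^×`, `0 ≤ i ≤ h-1`, `A ∈ GL(n,q)` with `A·Aᵀ = I` and
`b ∈ 𝔽_q^n` such that `γ(x) = a·σ^i(x)·A + b`, where `σ` is the coordinatewise
Frobenius `x ↦ x^p`. -/
theorem integral_automorphism_iff_semiaffine
    (p h n : ℕ) (hp : p.Prime) (hodd : Odd p) (hn : 3 ≤ n)
    (q : ℕ) (hq : q = p ^ h)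
    (F : Type) [Field F] [Fintype F] (hF : Fintype.card F = q)
    (γ : (Fin n → F) → (Fin n → F)) (hγ : Function.Bijective γ) :
    (∀ x y : Fin n → F,
        IsSquare (∑ j, (x j - y j) ^ 2) ↔ IsSquare (∑ j, (γ x j - γ y j) ^ 2))
    ↔
    (∃ (a : F) (i : ℕ) (A : Matrix (Fin n) (Fin n) F) (b : Fin n → F),
        a ≠ 0 ∧ i < h ∧ A * A.transpose = 1 ∧
        ∀ x : Fin n → F,
          γ x = a • Matrix.vecMul (fun k => (x k) ^ p ^ i) A + b) := by
  subst hq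
  have : Fact p.Prime := ⟨hp⟩
  have := charP_of_card_eq_prime_pow hF
  have hchar : ringChar F ≠ 2 := by
    rw [ringChar.eq F p]
    rintro rfl
    exact absurd hodd (by decide)
  have hsum : ∀ x y : Fin n → F, ∑ j, (x j - y j) ^ 2 = (x - y) ⬝ᵥ (x - y) := fun x y => by
    simp only [dotProduct, pow_two, Pi.sub_apply]
  simp only [hsum]
  constructor
  · intro hsq
    obtain ⟨σ, a, A, ha, hA, hγA⟩ := exists_semiaffine_of_integral hchar hn hγ hsq
    obtain ⟨i, hi, hσ⟩ := exists_eq_frobenius_pow hF σ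
    simp only [hσ] at hγA
    exact ⟨a, i, A, γ 0, ha, hi, hA, hγA⟩
  · rintro ⟨a, i, A, b, ha, -, hA, hγA⟩ x y
    exact (isSquare_dotProduct_self_semiaffine_iff hodd ha hA hγA x y).symm
end

section
/- Let p be an odd prime, q = p^h, and n ≥ 3. Let τ be a field automorphism of 𝔽_q, let L : 𝔽_q^n → 𝔽_q^n be a bijective τ-semilinear map (that is, L(x+y) = L(x)+L(y) and L(c·x) = τ(c)·L(x) for all c ∈ 𝔽_q and x, y ∈ 𝔽_q^n), let b ∈ 𝔽_q^n, and define γ(x) = L(x) + b. Then γ is an integral automorphism of 𝔽_q^n if and only if there exist a ∈ 𝔽_q^× and a matrix A ∈ GL(n,q) with A·Aᵀ = I such that L(x) = a·τ(x)·A for all x ∈ 𝔽_q^n, where τ(x) denotes τ applied coordinatewise. -/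
section

variable {F : Type*} [Field F]

/-- A polynomial of degree at most two all of whose values are nonzero squares is constant. -/
theorem eq_zero_of_forall_quadratic_isSquare [Fintype F] (hF : ringChar F ≠ 2) {a b c : F}
    (h : ∀ t : F, a * t ^ 2 + b * t + c ≠ 0 ∧ IsSquare (a * t ^ 2 + b * t + c)) :
    a = 0 ∧ b = 0 := by
  have ha : a = 0 := by
    by_contra ha
    obtain ⟨ν, hν⟩ := FiniteField.exists_nonsquare hF
    have hν0 : ν ≠ 0 := fun h0 => hν (h0 ▸ IsSquare.zero)
    obtain ⟨t, s, hts⟩ := FiniteField.exists_root_sum_quadratic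
      (f := Polynomial.C a * Polynomial.X ^ 2 + Polynomial.C b * Polynomial.X + Polynomial.C c)
      (g := Polynomial.C (-ν) * Polynomial.X ^ 2 + Polynomial.C 0 * Polynomial.X
        + Polynomial.C 0)
      (Polynomial.degree_quadratic ha) (Polynomial.degree_quadratic (neg_ne_zero.2 hν0))
      (FiniteField.odd_card_of_char_ne_two hF)
    simp only [Polynomial.eval_add, Polynomial.eval_mul, Polynomial.eval_C, Polynomial.eval_pow,
      Polynomial.eval_X] at hts
    obtain ⟨h0, r, hr⟩ := h t
    have hs : s ≠ 0 := by
      rintro rfl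
      exact h0 (by linear_combination hts)
    refine hν ⟨r / s, ?_⟩
    field_simp
    linear_combination hr - hts
  refine ⟨ha, ?_⟩
  by_contra hb
  refine (h (-c / b)).1 ?_
  rw [ha]
  field_simp
  ring

theorem exists_not_isSquare_add_mul [Fintype F] (hF : ringChar F ≠ 2) (α : F) {β : F}
    (hβ : β ≠ 0) :
    ∃ t : F, ¬ IsSquare (α + β * t) := by
  obtain ⟨ν, hν⟩ := FiniteField.exists_nonsquare hF
  refine ⟨(ν - α) / β, ?_⟩
  rwa [mul_div_cancel₀ _ hβ, add_sub_cancel]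

/-- If the squares are stable under a reflection `u ↦ 2 * α - u` with `α ≠ 0`, then they contain
every difference `k ^ 2 - l ^ 2` with `k ≠ 0`. -/
theorem isSquare_sq_sub_sq_of_reflection (hF : ringChar F ≠ 2) {α : F} (hα : α ≠ 0)
    (h : ∀ u : F, IsSquare u → IsSquare (2 * α - u)) {k : F} (hk : k ≠ 0) (l : F) :
    IsSquare (k ^ 2 - l ^ 2) := by
  obtain ⟨m, hm⟩ := h 0 IsSquare.zero
  rw [sub_zero] at hm
  have hm0 : m ≠ 0 := by
    rintro rfl
    exact mul_ne_zero (Ring.two_ne_zero hF) hα (by simpa using hm)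
  obtain ⟨r, hr⟩ := h ((l * m / k) ^ 2) (IsSquare.sq _)
  refine ⟨r * (k / m), ?_⟩
  have : k ^ 2 - l ^ 2 = (m * m - (l * m / k) ^ 2) * (k / m) ^ 2 := by
    field_simp
  rw [this, ← hm, hr]
  ring

theorem neg_isSquare_of_isSquare_linear_iff_quadratic [Fintype F] (hF : ringChar F ≠ 2)
    {α β c d : F}
    (hβ : β ≠ 0) (hc : IsSquare c)
    (h : ∀ t : F, IsSquare (α + β * t) ↔ IsSquare (d + c * t ^ 2)) :
    d ≠ 0 ∧ IsSquare (-d) := by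
  have h2 : (2 : F) ≠ 0 := Ring.two_ne_zero hF
  have hd : d ≠ 0 := by
    rintro rfl
    obtain ⟨t, ht⟩ := exists_not_isSquare_add_mul hF α hβ
    refine ht ((h t).2 ?_)
    rw [zero_add]
    exact hc.mul (IsSquare.sq t)
  refine ⟨hd, ?_⟩
  have hrefl : ∀ u : F, IsSquare u → IsSquare (2 * α - u) := by
    intro u hu
    have e₁ : u = α + β * ((u - α) / β) := by field_simp; ring
    have e₂ : 2 * α - u = α + β * (-((u - α) / β)) := by field_simp; ring
    rw [e₂, h, neg_sq, ← h, ← e₁]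
    exact hu
  have hd_iff : IsSquare α ↔ IsSquare d := by simpa using h 0
  by_cases hneg : IsSquare (-1 : F)
  · have hα : α = 0 := by
      by_contra hα
      obtain ⟨ν, hν⟩ := FiniteField.exists_nonsquare hF
      have hk : (ν + 1) / 2 ≠ 0 := by
        refine div_ne_zero (fun h0 => hν ?_) h2
        rwa [eq_neg_of_add_eq_zero_left h0]
      refine hν ?_
      have := isSquare_sq_sub_sq_of_reflection hF hα hrefl hk ((ν - 1) / 2)
      convert this using 1
      field_simp
      ring
    rw [neg_eq_neg_one_mul]
    exact hneg.mul (hd_iff.1 (hα ▸ IsSquare.zero))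
  · classical
    by_contra hnd
    have hds : IsSquare d := by
      by_contra hds
      rw [← quadraticChar_neg_one_iff_not_isSquare] at hneg hnd hds
      rw [neg_eq_neg_one_mul, map_mul, hneg, hds] at hnd
      norm_num at hnd
    obtain ⟨a, ha⟩ := hd_iff.2 hds
    by_cases hα : α = 0
    · obtain ⟨r, hr⟩ := hrefl 1 IsSquare.one
      refine hneg ⟨r, ?_⟩
      rw [← hr, hα]
      ring
    · have ha0 : a ≠ 0 := by
        rintro rfl
        exact hα (by simpa using ha)
      obtain ⟨m, hm⟩ := hrefl 0 IsSquare.zero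
      have := isSquare_sq_sub_sq_of_reflection hF hα hrefl one_ne_zero (m / a)
      refine hneg ?_
      convert this using 1
      field_simp
      linear_combination -hm + 2 * ha

variable {V : Type*} [AddCommGroup V] [Module F V]

theorem LinearMap.BilinForm.apply_add_smul_self {B : LinearMap.BilinForm F V} (hB : B.IsSymm)
    (x y : V) (t : F) :
    B (x + t • y) (x + t • y) = B x x + 2 * B x y * t + B y y * t ^ 2 := by
  have := hB.eq x y
  simp only [map_add, map_smul, LinearMap.add_apply, LinearMap.smul_apply, smul_eq_mul] at *
  rw [← this]
  ring

variable {B C : LinearMap.BilinForm F V}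

/-- Let `y` be isotropic for `B`. If `B x x` and `C x x` are simultaneously squares, then `y` is
isotropic for `C` as well. -/
theorem isotropic_of_isSquare_iff [Fintype F] [FiniteDimensional F V]
    (hF : ringChar F ≠ 2) (hV : 3 ≤ Module.finrank F V) (hB : B.IsSymm) (hC : C.IsSymm)
    (hBnd : ∀ x, (∀ y, B x y = 0) → x = 0) (hCnd : ∀ x, (∀ y, C x y = 0) → x = 0)
    (h : ∀ x, IsSquare (B x x) ↔ IsSquare (C x x)) {y : V} (hy : B y y = 0) :
    C y y = 0 := by
  by_contra hc
  have h2 : (2 : F) ≠ 0 := Ring.two_ne_zero hF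
  have hy0 : y ≠ 0 := by
    rintro rfl
    simp at hc
  have hcs : IsSquare (C y y) := (h y).1 (hy ▸ IsSquare.zero)
  have decomp : ∀ z, C y (z - (C y z / C y y) • y) = 0 := by
    intro z
    rw [map_sub, map_smul, smul_eq_mul, div_mul_cancel₀ _ hc, sub_self]
  have key : ∀ x, C y x = 0 → B y x ≠ 0 → C x x ≠ 0 ∧ IsSquare (-C x x) := by
    intro x hx hx'
    refine neg_isSquare_of_isSquare_linear_iff_quadratic hF (α := B x x) (β := 2 * B x y)
      (c := C y y) ?_ hcs fun t => ?_
    · rw [hB.eq y x |>.symm]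
      exact mul_ne_zero h2 hx'
    · have := h (x + t • y)
      rw [B.apply_add_smul_self hB, C.apply_add_smul_self hC, hy, ← hC.eq y x] at this
      simpa [hx] using this
  obtain ⟨x, hx, hx'⟩ : ∃ x, C y x = 0 ∧ B y x ≠ 0 := by
    by_contra! hcon
    refine hy0 (hBnd y fun z => ?_)
    have := hcon _ (decomp z)
    rwa [map_sub, map_smul, hy, smul_zero, sub_zero] at this
  obtain ⟨w, hw, hw0⟩ := Submodule.exists_mem_ne_zero_of_ne_bot
    (LinearMap.ker_ne_bot_of_finrank_lt (f := (B y).prod (C y))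
      (by rw [Module.finrank_prod, Module.finrank_self]; omega))
  obtain ⟨hBw, hCw⟩ : B y w = 0 ∧ C y w = 0 := by simpa using hw
  have orth : ∀ x, C y x = 0 → B y x ≠ 0 → C x w = 0 := by
    intro x hx hx'
    have := (eq_zero_of_forall_quadratic_isSquare hF (a := -C w w) (b := -(2 * C x w))
      (c := -C x x) fun t => ?_).2
    · simpa [h2] using this
    · have := key (x + t • w) (by simp [hx, hCw]) (by simpa [hBw] using hx')
      rw [C.apply_add_smul_self hC] at this
      have e : -C w w * t ^ 2 + -(2 * C x w) * t + -C x x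
        = -(C x x + 2 * C x w * t + C w w * t ^ 2) := by ring
      rw [e]
      exact ⟨neg_ne_zero.2 this.1, this.2⟩
  have orth' : ∀ z, C y z = 0 → C z w = 0 := by
    intro z hz
    by_cases hz' : B y z = 0
    · have h₁ := orth (z + x) (by simp [hz, hx]) (by simpa [hz'] using hx')
      rw [map_add, LinearMap.add_apply, orth x hx hx', add_zero] at h₁
      exact h₁
    · exact orth z hz hz'
  refine hw0 (hCnd w fun z => ?_)
  have := orth' _ (decomp z)
  rw [map_sub, map_smul, LinearMap.sub_apply, LinearMap.smul_apply, hCw, smul_zero, sub_zero]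
    at this
  rw [← hC.eq z w]
  exact this

/-- Two nondegenerate quadratic forms in at least three variables over a finite field of odd
characteristic which take square values at the same vectors are proportional, provided one of them
has a nonzero isotropic vector. -/
theorem exists_smul_of_isSquare_iff [Fintype F] [FiniteDimensional F V]
    (hF : ringChar F ≠ 2) (hV : 3 ≤ Module.finrank F V) (hB : B.IsSymm) (hC : C.IsSymm)
    (hBnd : ∀ x, (∀ y, B x y = 0) → x = 0) (hCnd : ∀ x, (∀ y, C x y = 0) → x = 0)
    (h : ∀ x, IsSquare (B x x) ↔ IsSquare (C x x)) {y : V} (hy0 : y ≠ 0) (hy : B y y = 0) :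
    ∃ c : F, ∀ x z, C x z = c * B x z := by
  have h2 : (2 : F) ≠ 0 := Ring.two_ne_zero hF
  have hy' := isotropic_of_isSquare_iff hF hV hB hC hBnd hCnd h hy
  have perp : ∀ x, B x y = 0 → C x y = 0 := by
    intro x hx
    by_contra hx'
    have key : ∀ t, IsSquare (B x x) ↔ IsSquare (C x x + 2 * C x y * t) := by
      intro t
      have := h (x + t • y)
      rw [B.apply_add_smul_self hB, C.apply_add_smul_self hC, hy, hy', hx] at this
      simpa using this
    obtain ⟨t, ht⟩ := exists_not_isSquare_add_mul hF (C x x) (mul_ne_zero h2 hx')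
    refine ht ((key t).1 ((key (-C x x / (2 * C x y))).2 ?_))
    rw [mul_div_cancel₀ _ (mul_ne_zero h2 hx'), add_neg_cancel]
    exact IsSquare.zero
  obtain ⟨w, hw⟩ : ∃ w, B w y ≠ 0 := by
    by_contra! hcon
    exact hy0 (hBnd y fun z => (hB.eq z y).symm.trans (hcon z))
  obtain ⟨c, hcw⟩ : ∃ c, C w y = c * B w y := ⟨C w y / B w y, (div_mul_cancel₀ _ hw).symm⟩
  have prop : ∀ x, C x y = c * B x y := by
    intro x
    have := perp (x - (B x y / B w y) • w) (by
      simp only [map_sub, map_smul, LinearMap.sub_apply, LinearMap.smul_apply, smul_eq_mul]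
      rw [div_mul_cancel₀ _ hw, sub_self])
    simp only [map_sub, map_smul, LinearMap.sub_apply, LinearMap.smul_apply, smul_eq_mul] at this
    rw [hcw] at this
    field_simp at this
    linear_combination this
  have diag_of_ne : ∀ x, B x y ≠ 0 → C x x = c * B x x := by
    intro x hx
    have hiso : B (x + (-B x x / (2 * B x y)) • y) (x + (-B x x / (2 * B x y)) • y) = 0 := by
      rw [B.apply_add_smul_self hB, hy, mul_div_cancel₀ _ (mul_ne_zero h2 hx)]
      ring
    have := isotropic_of_isSquare_iff hF hV hB hC hBnd hCnd h hiso
    rw [C.apply_add_smul_self hC, hy', prop] at this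
    have e : 2 * (c * B x y) * (-B x x / (2 * B x y)) = -(c * B x x) := by field_simp
    rw [e] at this
    linear_combination this
  have diag : ∀ x, C x x = c * B x x := by
    intro x
    by_cases hx : B x y = 0
    · have h₁ := diag_of_ne (x + (1 : F) • w) (by simpa [hx] using hw)
      have h₂ := diag_of_ne (x + (-1 : F) • w) (by simpa [hx] using hw)
      have h₃ := diag_of_ne w hw
      rw [B.apply_add_smul_self hB, C.apply_add_smul_self hC] at h₁ h₂
      refine mul_left_cancel₀ h2 ?_
      linear_combination h₁ + h₂ - 2 * h₃
    · exact diag_of_ne x hx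
  refine ⟨c, fun x z => ?_⟩
  have h₁ := diag (x + (1 : F) • z)
  rw [B.apply_add_smul_self hB, C.apply_add_smul_self hC, diag x, diag z] at h₁
  refine mul_left_cancel₀ h2 ?_
  linear_combination h₁

theorem exists_ne_zero_dotProduct_self_eq_zero [Fintype F] (hF : ringChar F ≠ 2) {n : ℕ}
    (hn : 3 ≤ n) : ∃ y : Fin n → F, y ≠ 0 ∧ y ⬝ᵥ y = 0 := by
  obtain ⟨k, rfl⟩ := Nat.exists_eq_add_of_le' hn
  obtain ⟨a, b, hab⟩ := FiniteField.exists_root_sum_quadratic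
    (f := (Polynomial.X ^ 2 : Polynomial F)) (g := Polynomial.X ^ 2 - Polynomial.C (-1))
    (Polynomial.degree_X_pow 2) (Polynomial.degree_X_pow_sub_C (by decide) _)
    (FiniteField.odd_card_of_char_ne_two hF)
  simp only [Polynomial.eval_sub, Polynomial.eval_C, Polynomial.eval_pow, Polynomial.eval_X]
    at hab
  refine ⟨Fin.cons 1 (Fin.cons a (Fin.cons b 0)), fun h0 => ?_, ?_⟩
  · simpa using congrFun h0 0
  · simp only [dotProduct, Fin.sum_univ_succ, Fin.cons_zero, Fin.cons_succ, Pi.zero_apply,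
      mul_zero, Finset.sum_const_zero]
    linear_combination hab

/-- A matrix acting by a linear map which preserves squareness of the sum of squares is a
similarity. -/
theorem mul_transpose_eq_sq_smul_one [Fintype F] (hF : ringChar F ≠ 2) {n : ℕ} (hn : 3 ≤ n)
    (M : Matrix (Fin n) (Fin n) F) (hM : Function.Injective fun x => Matrix.vecMul x M)
    (h : ∀ x : Fin n → F,
      IsSquare (x ⬝ᵥ x) ↔ IsSquare (Matrix.vecMul x M ⬝ᵥ Matrix.vecMul x M)) :
    ∃ a : F, a ≠ 0 ∧ M * M.transpose = a ^ 2 • (1 : Matrix (Fin n) (Fin n) F) := by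
  obtain ⟨y, hy0, hy⟩ := exists_ne_zero_dotProduct_self_eq_zero hF hn
  have hBapp : ∀ x z, Matrix.toBilin' (1 : Matrix (Fin n) (Fin n) F) x z = x ⬝ᵥ z := by
    intro x z
    rw [Matrix.toBilin'_apply', Matrix.one_mulVec]
  have hCapp : ∀ x z, Matrix.toBilin' (M * M.transpose) x z
      = Matrix.vecMul x M ⬝ᵥ Matrix.vecMul z M := by
    intro x z
    rw [Matrix.toBilin'_apply', ← Matrix.mulVec_mulVec, Matrix.mulVec_transpose,
      Matrix.dotProduct_mulVec]
  have hCnd : ∀ x, (∀ z, Matrix.toBilin' (M * M.transpose) x z = 0) → x = 0 := by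
    intro x hx
    have : Matrix.vecMul x M = 0 := by
      refine dotProduct_eq_zero _ fun z => ?_
      obtain ⟨w, rfl⟩ := Finite.surjective_of_injective hM z
      rw [← hCapp, hx]
    exact hM (by simpa using this)
  obtain ⟨c, hc⟩ := exists_smul_of_isSquare_iff (B := Matrix.toBilin' 1)
    (C := Matrix.toBilin' (M * M.transpose)) hF (by simpa using hn)
    ⟨fun x z => by simp [hBapp, dotProduct_comm]⟩
    ⟨fun x z => by simp [hCapp, dotProduct_comm]⟩
    (fun x hx => dotProduct_eq_zero _ fun z => by rw [← hBapp, hx]) hCnd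
    (fun x => by rw [hBapp, hCapp]; exact h x) hy0 (by rw [hBapp, hy])
  have hMc : M * M.transpose = c • (1 : Matrix (Fin n) (Fin n) F) := by
    ext i j
    have := hc (Pi.single i 1) (Pi.single j 1)
    rwa [Matrix.toBilin'_single, Matrix.toBilin'_single] at this
  have hcs : IsSquare c := by
    let e : Fin n → F := Pi.single ⟨0, by omega⟩ 1
    have he : e ⬝ᵥ e = 1 := by simp [e]
    have := (h e).1 (he ▸ IsSquare.one)
    rwa [← hCapp, hc, hBapp, he, mul_one] at this
  obtain ⟨a, rfl⟩ := hcs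
  refine ⟨a, ?_, by rw [hMc, sq]⟩
  rintro rfl
  exact hy0 (hCnd y fun z => by rw [hc]; simp)

/-- A semilinear map is coordinatewise application of the automorphism followed by a matrix. -/
theorem exists_matrix_of_semilinear {n : ℕ} (τ : F ≃+* F) (L : (Fin n → F) → (Fin n → F))
    (hadd : ∀ x y, L (x + y) = L x + L y) (hsmul : ∀ (c : F) x, L (c • x) = τ c • L x) :
    ∃ M : Matrix (Fin n) (Fin n) F, ∀ x, L x = Matrix.vecMul (fun k => τ (x k)) M := by
  let f : (Fin n → F) →ₛₗ[(τ : F →+* F)] (Fin n → F) :=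
    { toFun := L, map_add' := hadd, map_smul' := hsmul }
  refine ⟨Matrix.of fun i => L (Pi.single i 1), fun x => ?_⟩
  change f x = _
  conv_lhs => rw [pi_eq_sum_univ' x, map_sum]
  ext j
  simp only [map_smulₛₗ, Finset.sum_apply, Pi.smul_apply, smul_eq_mul, Matrix.vecMul, dotProduct,
    Matrix.of_apply]
  rfl

end


/-- Let `p` be an odd prime, `q = p^h`, `n ≥ 3`. Let `τ` be a
field automorphism of `𝔽_q`, let `L : 𝔽_q^n → 𝔽_q^n` be a bijective
`τ`-semilinear map, `b ∈ 𝔽_q^n`, and `γ(x) = L(x) + b`. Then `γ` is an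
integral automorphism of `𝔽_q^n` if and only if there are `a ∈ 𝔽_q^×` and a
matrix `A ∈ GL(n,q)` with `A·Aᵀ = I` such that `L(x) = a·τ(x)·A` for all `x`,
where `τ` is applied coordinatewise. -/
theorem integral_automorphism_semilinear_iff
    (p h n : ℕ) (hp : p.Prime) (hodd : Odd p) (hn : 3 ≤ n)
    (q : ℕ) (hq : q = p ^ h)
    (F : Type) [Field F] [Fintype F] (hF : Fintype.card F = q)
    (τ : F ≃+* F)
    (L : (Fin n → F) → (Fin n → F)) (hLbij : Function.Bijective L)
    (hLadd : ∀ x y : Fin n → F, L (x + y) = L x + L y)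
    (hLsmul : ∀ (c : F) (x : Fin n → F), L (c • x) = τ c • L x)
    (b : Fin n → F)
    (γ : (Fin n → F) → (Fin n → F)) (hγdef : ∀ x : Fin n → F, γ x = L x + b) :
    (Function.Bijective γ ∧
      ∀ x y : Fin n → F,
        IsSquare (∑ j, (x j - y j) ^ 2) ↔ IsSquare (∑ j, (γ x j - γ y j) ^ 2))
    ↔
    (∃ (a : F) (A : Matrix (Fin n) (Fin n) F),
        a ≠ 0 ∧ A * A.transpose = 1 ∧
        ∀ x : Fin n → F, L x = a • Matrix.vecMul (fun k => τ (x k)) A) := by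
  have hchar : ringChar F ≠ 2 := by
    rw [Ne, FiniteField.even_card_iff_char_two, hF, hq]
    have := Nat.odd_iff.1 (hodd.pow (n := h))
    omega
  have hγsub : ∀ x y, ∑ j, (γ x j - γ y j) ^ 2 = L (x - y) ⬝ᵥ L (x - y) := by
    intro x y
    have hsub : L x = L (x - y) + L y := by rw [← hLadd, sub_add_cancel]
    simp [hγdef, hsub, dotProduct, sq]
  have hsum : ∀ x y : Fin n → F, ∑ j, (x j - y j) ^ 2 = (x - y) ⬝ᵥ (x - y) := by
    intro x y
    simp [dotProduct, sq]
  have hτdot : ∀ x : Fin n → F,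
      (fun k => τ (x k)) ⬝ᵥ (fun k => τ (x k)) = τ (x ⬝ᵥ x) := by
    intro x
    simp [dotProduct]
  have hτsq : ∀ s : F, IsSquare (τ s) ↔ IsSquare s := fun s =>
    ⟨fun hs => by simpa using hs.map τ.symm, fun hs => hs.map τ⟩
  have hγbij : Function.Bijective γ := by
    have : γ = Equiv.addRight b ∘ L := funext hγdef
    rw [this]
    exact (Equiv.addRight b).bijective.comp hLbij
  simp only [hγbij, true_and, hγsub, hsum]
  constructor
  · intro hsq
    obtain ⟨M, hM⟩ := exists_matrix_of_semilinear τ L hLadd hLsmul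
    have hvec : ∀ x, Matrix.vecMul x M = L fun k => τ.symm (x k) := by
      intro x
      simp [hM]
    obtain ⟨a, ha, haM⟩ := mul_transpose_eq_sq_smul_one hchar hn M
      (fun x y hxy => by
        simp only [hvec] at hxy
        exact funext fun k => τ.symm.injective (congrFun (hLbij.1 hxy) k))
      (fun x => by
        rw [hvec]
        have := hsq (fun k => τ.symm (x k)) 0
        rw [sub_zero, ← hτsq, ← hτdot] at this
        simpa using this)
    refine ⟨a, a⁻¹ • M, ha, ?_, fun x => ?_⟩
    · rw [Matrix.transpose_smul, Matrix.smul_mul, Matrix.mul_smul, haM, smul_smul, smul_smul]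
      field_simp
      simp
    · rw [Matrix.vecMul_smul, smul_smul, mul_inv_cancel₀ ha, one_smul, hM]
  · rintro ⟨a, A, ha, hA, hL⟩ x y
    have hdot : L (x - y) ⬝ᵥ L (x - y) = a ^ 2 * τ ((x - y) ⬝ᵥ (x - y)) := by
      rw [hL, smul_dotProduct, dotProduct_smul, ← Matrix.dotProduct_mulVec,
        ← Matrix.mulVec_transpose A, Matrix.mulVec_mulVec, hA, Matrix.one_mulVec, hτdot]
      simp only [smul_eq_mul]
      ring
    rw [hdot, ← hτsq]
    refine ⟨fun hs => (IsSquare.sq a).mul hs, fun hs => ?_⟩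
    have := (IsSquare.sq a⁻¹).mul hs
    rwa [← mul_assoc, ← mul_pow, inv_mul_cancel₀ ha, one_pow, one_mul] at this
end

section
/- Let F be a field with characteristic different from 2, let V be a finite-dimensional F-vector space with dim V ≥ 3, and let B be a nondegenerate symmetric bilinear form on V which is not anisotropic (there exists x ≠ 0 with B(x,x) = 0). For a ∈ V let C(a) = { x ∈ V : B(x−a, x−a) = 0 }. If f : V → V is a bijection which preserves cones, i.e. f(C(a)) = C(f(a)) for all a ∈ V, then there exist a field automorphism ρ of F, a bijective ρ-semilinear map L : V → V, a nonzero scalar a ∈ F, and b ∈ V such that f(x) = L(x) + b for all x ∈ V and B(L(x), L(y)) = a·ρ(B(x,y)) for all x, y ∈ V. -/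
section NullVectors

variable {F V : Type} [Field F] [AddCommGroup V] [Module F V] {B : LinearMap.BilinForm F V}

theorem apply_sub_sub_self (hs : ∀ x y, B x y = B y x) (x y : V) :
    B (x - y) (x - y) = B x x - 2 * B x y + B y y := by
  simp only [map_sub, LinearMap.sub_apply, hs y x]
  ring

theorem exists_null_pairing_eq_one (h2 : (2 : F) ≠ 0) (hs : ∀ x y, B x y = B y x)
    (hnd : ∀ x, (∀ y, B x y = 0) → x = 0) {n : V} (hn0 : n ≠ 0) (hn : B n n = 0) :
    ∃ m, B m m = 0 ∧ B m n = 1 := by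
  obtain ⟨y, hy⟩ : ∃ y, B n y ≠ 0 := by
    by_contra! h
    exact hn0 (hnd n h)
  refine ⟨(B n y)⁻¹ • y - ((B n y)⁻¹ * (B n y)⁻¹ * B y y / 2) • n, ?_, ?_⟩
  · simp only [map_sub, map_smul, LinearMap.sub_apply, LinearMap.smul_apply, smul_eq_mul, hn,
      hs y n]
    field_simp
    ring
  · simp only [map_sub, map_smul, LinearMap.sub_apply, LinearMap.smul_apply, smul_eq_mul, hn,
      hs y n]
    field_simp
    ring

theorem exists_hyperbolic_decomposition (hs : ∀ x y, B x y = B y x) {m n : V}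
    (hm : B m m = 0) (hn : B n n = 0) (hmn : B m n = 1) (y : V) :
    ∃ w, B w m = 0 ∧ B w n = 0 ∧ y = B y n • m + B y m • n + w := by
  refine ⟨y - B y n • m - B y m • n, ?_, ?_, by abel⟩ <;>
    simp [hm, hn, hmn, hs n m]

theorem exists_anisotropic_orthogonal [FiniteDimensional F V] (hdim : 3 ≤ Module.finrank F V)
    (h2 : (2 : F) ≠ 0) (hs : ∀ x y, B x y = B y x) (hnd : ∀ x, (∀ y, B x y = 0) → x = 0)
    {m n : V} (hm : B m m = 0) (hn : B n n = 0) (hmn : B m n = 1) :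
    ∃ w, B w m = 0 ∧ B w n = 0 ∧ B w w ≠ 0 := by
  obtain ⟨v, hv⟩ : ∃ v, v ∉ Submodule.span F {m, n} := by
    by_contra! h
    have htop : Submodule.span F {m, n} = ⊤ := Submodule.eq_top_iff'.2 h
    classical
    have h3 := finrank_span_finset_le_card (R := F) ({m, n} : Finset V)
    have h4 : ({m, n} : Finset V).card ≤ 2 := Finset.card_le_two
    rw [Set.finrank, Finset.coe_pair, htop, finrank_top] at h3
    omega
  obtain ⟨w, hwm, hwn, hw⟩ := exists_hyperbolic_decomposition hs hm hn hmn v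
  have hw0 : w ≠ 0 := by
    rintro rfl
    apply hv
    rw [hw, add_zero]
    exact Submodule.mem_span_pair.2 ⟨_, _, rfl⟩
  obtain ⟨y, hy⟩ : ∃ y, B w y ≠ 0 := by
    by_contra! h
    exact hw0 (hnd w h)
  obtain ⟨u, hum, hun, hu⟩ := exists_hyperbolic_decomposition hs hm hn hmn y
  have hwu : B w u ≠ 0 := by
    rw [hu] at hy
    simpa [hwm, hwn] using hy
  by_contra! h
  have h3 := h (w + u) (by simp [hwm, hum]) (by simp [hwn, hun])
  simp only [map_add, LinearMap.add_apply, h w hwm hwn, h u hum hun, hs u w] at h3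
  have h4 : 2 * B w u = 0 := by linear_combination h3
  exact hwu ((mul_eq_zero.1 h4).resolve_left h2)

/-- A property stable under sums holds everywhere as soon as it holds for the null vectors that
are not orthogonal to a fixed nonzero null vector. -/
theorem null_vector_induction [FiniteDimensional F V] (hdim : 3 ≤ Module.finrank F V)
    (h2 : (2 : F) ≠ 0) (hs : ∀ x y, B x y = B y x) (hnd : ∀ x, (∀ y, B x y = 0) → x = 0)
    {n : V} (hn0 : n ≠ 0) (hn : B n n = 0) {p : V → Prop} (zero : p 0)
    (add : ∀ x y, p x → p y → p (x + y)) (null : ∀ k, B k k = 0 → B k n ≠ 0 → p k) (y : V) :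
    p y := by
  obtain ⟨m, hm, hmn⟩ := exists_null_pairing_eq_one h2 hs hnd hn0 hn
  have hp_m (a : F) : p (a • m) := by
    by_cases ha : a = 0
    · simpa [ha] using zero
    · exact null _ (by simp [hm]) (by simpa [hmn] using ha)
  have hp_k (a : F) (ha : a ≠ 0) (w : V) (hwm : B w m = 0) (hwn : B w n = 0) :
      p (a • m + (-(B w w) / (2 * a)) • n + w) := by
    refine null _ ?_ ?_
    · simp only [map_add, map_smul, LinearMap.add_apply, LinearMap.smul_apply, smul_eq_mul, hn, hm,
        hmn, hwm, hwn, hs m w, hs n w, hs n m]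
      field_simp
      ring
    · simpa [hn, hmn, hwn] using ha
  have hp_n (b : F) : p (b • n) := by
    by_cases hb : b = 0
    · simpa [hb] using zero
    obtain ⟨w, hwm, hwn, hw⟩ := exists_anisotropic_orthogonal hdim h2 hs hnd hm hn hmn
    have ha : -(B w w) / b ≠ 0 := div_ne_zero (neg_ne_zero.2 hw) hb
    have h := add _ _ (add _ _ (hp_k _ ha w hwm hwn)
      (hp_k _ ha (-w) (by simpa using hwm) (by simpa using hwn))) (hp_m (-(2 * (-(B w w) / b))))
    convert h using 1
    have hb2 : -(B w w) / (2 * (-(B w w) / b)) = b / 2 := by field_simp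
    have hb3 : -(B (-w) (-w)) / (2 * (-(B w w) / b)) = b / 2 := by
      rw [← hb2]; simp
    rw [hb2, hb3]
    have hb4 : b • n = (b / 2) • n + (b / 2) • n := by rw [← add_smul]; congr 1; field_simp; ring
    rw [hb4]
    module
  obtain ⟨w, hwm, hwn, hw⟩ := exists_hyperbolic_decomposition hs hm hn hmn y
  have hp_w : p w := by
    have h := add _ _ (add _ _ (hp_k 1 one_ne_zero w hwm hwn) (hp_m (-1)))
      (hp_n (-(-(B w w) / (2 * 1))))
    convert h using 1
    module
  rw [hw]
  exact add _ _ (add _ _ (hp_m _) (hp_n _)) hp_w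

theorem mem_null_line_of_forall_adjacent (h2 : (2 : F) ≠ 0) (hs : ∀ x y, B x y = B y x)
    (hnd : ∀ x, (∀ y, B x y = 0) → x = 0) {n : V} (hn0 : n ≠ 0) (hn : B n n = 0) {w : V}
    (h : ∀ z, B z z = 0 → B z n = 0 → B (w - z) (w - z) = 0) : ∃ t : F, w = t • n := by
  obtain ⟨m, hm, hmn⟩ := exists_null_pairing_eq_one h2 hs hnd hn0 hn
  have hw : B w w = 0 := by simpa using h 0 (by simp) (by simp)
  have hz (z : V) (hz : B z z = 0) (hzn : B z n = 0) : B w z = 0 := by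
    have h1 := h z hz hzn
    simp only [map_sub, LinearMap.sub_apply, hw, hz, hs z w] at h1
    have h3 : 2 * B w z = 0 := by linear_combination -h1
    exact (mul_eq_zero.1 h3).resolve_left h2
  obtain ⟨u, hum, hun, hu⟩ := exists_hyperbolic_decomposition hs hm hn hmn w
  rw [hz n hn hn, zero_smul, zero_add] at hu
  refine ⟨B w m, ?_⟩
  suffices hu0 : u = 0 by rwa [hu0, add_zero] at hu
  by_contra hu0
  obtain ⟨y, hy⟩ : ∃ y, B u y ≠ 0 := by
    by_contra! h
    exact hu0 (hnd u h)
  obtain ⟨v, hvm, hvn, hv⟩ := exists_hyperbolic_decomposition hs hm hn hmn y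
  have huv : B u v ≠ 0 := by
    rw [hv] at hy
    simpa [hum, hun] using hy
  have huu : B u u = 0 := by
    rw [hu] at hw
    simpa [hn, hun, hs n u] using hw
  have h3 := hz (v - (B v v / (2 * B u v)) • u) (by
    simp only [map_sub, map_smul, LinearMap.sub_apply, LinearMap.smul_apply, smul_eq_mul, huu,
      hs v u]
    field_simp
    ring) (by simp [hvn, hun])
  rw [hu] at h3
  simp [huu, hun, hs n v, hvn, hs n u] at h3
  exact huv h3

theorem exists_orthogonal_not_orthogonal (h2 : (2 : F) ≠ 0) (hs : ∀ x y, B x y = B y x)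
    (hnd : ∀ x, (∀ y, B x y = 0) → x = 0) {n k : V} (hn0 : n ≠ 0) (hn : B n n = 0)
    (hk : ∀ t : F, k ≠ t • n) : ∃ u, B u n = 0 ∧ B u k ≠ 0 := by
  obtain ⟨m, hm, hmn⟩ := exists_null_pairing_eq_one h2 hs hnd hn0 hn
  obtain ⟨y, hy⟩ : ∃ y, B (k - B m k • n) y ≠ 0 := by
    by_contra! h
    exact hk _ (sub_eq_zero.1 (hnd _ h))
  refine ⟨y - B y n • m, by simp [hmn], fun h => hy ?_⟩
  simp only [map_sub, map_smul, LinearMap.sub_apply, LinearMap.smul_apply, smul_eq_mul] at h ⊢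
  rw [hs k y, hs n y]
  linear_combination h

theorem pairing_ne_zero_iff_exists (h2 : (2 : F) ≠ 0) (hs : ∀ x y, B x y = B y x) {n : V}
    (hn : B n n = 0) (d : V) :
    B d n ≠ 0 ↔ ∃ s t : F, B (d - s • n) (d - s • n) = 0 ∧ B (d - t • n) (d - t • n) ≠ 0 := by
  have key (t : F) : B (d - t • n) (d - t • n) = B d d - 2 * t * B d n := by
    simp only [map_sub, map_smul, LinearMap.sub_apply, LinearMap.smul_apply, smul_eq_mul, hn,
      hs n d]
    ring
  simp only [key]
  constructor
  · intro h
    refine ⟨B d d / (2 * B d n), B d d / (2 * B d n) + 1, by field_simp; ring, ?_⟩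
    have : B d d - 2 * (B d d / (2 * B d n) + 1) * B d n = -(2 * B d n) := by field_simp; ring
    rw [this]
    exact neg_ne_zero.2 (mul_ne_zero h2 h)
  · rintro ⟨s, t, h, h'⟩ h0
    simp_all

end NullVectors

section ConePreserving

variable {F V : Type} [Field F] [AddCommGroup V] [Module F V] {B : LinearMap.BilinForm F V}

/-- A permutation of `V` that preserves, in both directions, the relation of differing by a null
vector. -/
def PreservesNull (B : LinearMap.BilinForm F V) (f : V ≃ V) : Prop :=
  ∀ x y, B (f x - f y) (f x - f y) = 0 ↔ B (x - y) (x - y) = 0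

variable {f : V ≃ V}

theorem PreservesNull.symm (hf : PreservesNull B f) : PreservesNull B f.symm := fun x y => by
  simpa using (hf (f.symm x) (f.symm y)).symm

theorem PreservesNull.null_displacement (hf : PreservesNull B f) {n : V} (hn : B n n = 0) (x : V) :
    B (f (x + n) - f x) (f (x + n) - f x) = 0 :=
  (hf _ _).2 (by simpa using hn)

theorem displacement_ne_zero {n : V} (hn0 : n ≠ 0) (x : V) : f (x + n) - f x ≠ 0 := by
  simpa [sub_eq_zero] using hn0

theorem PreservesNull.exists_image_eq (hf : PreservesNull B f) (h2 : (2 : F) ≠ 0)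
    (hs : ∀ x y, B x y = B y x) (hnd : ∀ x, (∀ y, B x y = 0) → x = 0) {n : V} (hn0 : n ≠ 0)
    (hn : B n n = 0) (x : V) (t : F) :
    ∃ s : F, f (x + t • n) = f x + s • (f (x + n) - f x) := by
  have hn' := hf.null_displacement hn x
  obtain ⟨s, hs'⟩ := mem_null_line_of_forall_adjacent h2 hs hnd
    (displacement_ne_zero (f := f) hn0 x)
    hn' (w := f (x + t • n) - f x) (by
      intro z hz hzn
      obtain ⟨y, hy⟩ := f.surjective (f x + z)
      obtain rfl : z = f y - f x := by rw [hy]; abel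
      have h1 := (hf _ _).1 hz
      have h3 : B (y - (x + n)) (y - (x + n)) = 0 := by
        rw [← hf]
        have e : f y - f (x + n) = (f y - f x) - (f (x + n) - f x) := by abel
        rw [e, apply_sub_sub_self hs, hz, hn', hzn]
        ring
      have h4 : B (y - x) n = 0 := by
        have e : y - (x + n) = (y - x) - n := by abel
        rw [e, apply_sub_sub_self hs, h1, hn] at h3
        have h5 : 2 * B (y - x) n = 0 := by linear_combination -h3
        exact (mul_eq_zero.1 h5).resolve_left h2
      have e : f (x + t • n) - f x - (f y - f x) = f (x + t • n) - f y := by abel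
      rw [e, hf]
      have e : x + t • n - y = t • n - (y - x) := by abel
      rw [e, apply_sub_sub_self hs, h1, map_smul, map_smul, LinearMap.smul_apply,
        LinearMap.smul_apply, hn, hs n (y - x), h4]
      simp)
  exact ⟨s, by rw [← hs']; abel⟩

theorem PreservesNull.exists_preimage_eq (hf : PreservesNull B f) (h2 : (2 : F) ≠ 0)
    (hs : ∀ x y, B x y = B y x) (hnd : ∀ x, (∀ y, B x y = 0) → x = 0) {n : V} (hn0 : n ≠ 0)
    (hn : B n n = 0) (x : V) (s : F) :
    ∃ t : F, f (x + t • n) = f x + s • (f (x + n) - f x) := by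
  obtain ⟨t, ht⟩ := hf.symm.exists_image_eq h2 hs hnd (displacement_ne_zero (f := f) hn0 x)
    (hf.null_displacement hn x) (f x) s
  refine ⟨t, ?_⟩
  rw [add_sub_cancel, f.symm_apply_apply, f.symm_apply_apply, add_sub_cancel_left] at ht
  rw [← ht, f.apply_symm_apply]

theorem PreservesNull.pairing_ne_zero (hf : PreservesNull B f) (h2 : (2 : F) ≠ 0)
    (hs : ∀ x y, B x y = B y x) (hnd : ∀ x, (∀ y, B x y = 0) → x = 0) {n : V} (hn0 : n ≠ 0)
    (hn : B n n = 0) {x z : V} (h : B (z - x) n ≠ 0) :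
    B (f z - f x) (f (x + n) - f x) ≠ 0 := by
  obtain ⟨s, t, h3, h4⟩ := (pairing_ne_zero_iff_exists h2 hs hn _).1 h
  obtain ⟨s', hs'⟩ := hf.exists_image_eq h2 hs hnd hn0 hn x s
  obtain ⟨t', ht'⟩ := hf.exists_image_eq h2 hs hnd hn0 hn x t
  refine (pairing_ne_zero_iff_exists h2 hs (hf.null_displacement hn x) _).2 ⟨s', t', ?_, ?_⟩
  · rw [sub_sub, ← hs', hf, ← sub_sub]; exact h3
  · rw [sub_sub, ← ht', Ne, hf, ← sub_sub]; exact h4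

theorem PreservesNull.pairing_eq_zero_iff (hf : PreservesNull B f) (h2 : (2 : F) ≠ 0)
    (hs : ∀ x y, B x y = B y x) (hnd : ∀ x, (∀ y, B x y = 0) → x = 0) {n : V} (hn0 : n ≠ 0)
    (hn : B n n = 0) (x z : V) :
    B (f z - f x) (f (x + n) - f x) = 0 ↔ B (z - x) n = 0 := by
  constructor
  · exact fun h => by_contra fun h' => hf.pairing_ne_zero h2 hs hnd hn0 hn h' h
  · intro h
    by_contra h'
    apply hf.symm.pairing_ne_zero h2 hs hnd (displacement_ne_zero (f := f) hn0 x)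
      (hf.null_displacement hn x) h'
    simpa using h

theorem PreservesNull.displacement_parallel (hf : PreservesNull B f) (h2 : (2 : F) ≠ 0)
    (hs : ∀ x y, B x y = B y x) (hnd : ∀ x, (∀ y, B x y = 0) → x = 0) {n : V} (hn0 : n ≠ 0)
    (hn : B n n = 0) (x y : V) : ∃ t : F, f (y + n) - f y = t • (f (x + n) - f x) := by
  by_contra! h
  obtain ⟨u, hu, hu'⟩ := exists_orthogonal_not_orthogonal h2 hs hnd
    (displacement_ne_zero (f := f) hn0 x) (hf.null_displacement hn x) h
  have key (c : F) : B (f x + c • u - f y) (f (y + n) - f y) =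
      B (f x - f y) (f (y + n) - f y) + c * B u (f (y + n) - f y) := by
    rw [add_sub_right_comm, map_add, LinearMap.add_apply, map_smul, LinearMap.smul_apply,
      smul_eq_mul]
  have iff_zero (c : F) :
      B (f x + c • u - f y) (f (y + n) - f y) = 0 ↔ B (x - y) n = 0 := by
    obtain ⟨z, hz⟩ := f.surjective (f x + c • u)
    have h3 : B (z - x) n = 0 := by
      rw [← hf.pairing_eq_zero_iff h2 hs hnd hn0 hn, hz, add_sub_cancel_left, map_smul,
        LinearMap.smul_apply, hu, smul_zero]
    rw [← hz, hf.pairing_eq_zero_iff h2 hs hnd hn0 hn, ← sub_add_sub_cancel z x y, map_add,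
      LinearMap.add_apply, h3, zero_add]
  have h3 := (iff_zero (-(B (f x - f y) (f (y + n) - f y)) / B u (f (y + n) - f y))).1 (by
    rw [key, div_mul_cancel₀ _ hu', add_neg_cancel])
  have h4 := (iff_zero 0).2 h3
  have h5 := (iff_zero 1).2 h3
  rw [key] at h4 h5
  exact hu' (by linear_combination h5 - h4)

theorem PreservesNull.displacement_add (hf : PreservesNull B f) (h2 : (2 : F) ≠ 0)
    (hs : ∀ x y, B x y = B y x) (hnd : ∀ x, (∀ y, B x y = 0) → x = 0) {n k : V} (hn0 : n ≠ 0)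
    (hn : B n n = 0) (hk : B k k = 0) (hkn : B k n ≠ 0) (x : V) :
    f (x + k + n) - f (x + k) = f (x + n) - f x := by
  have hk0 : k ≠ 0 := by rintro rfl; simp at hkn
  obtain ⟨s, h1⟩ := hf.displacement_parallel h2 hs hnd hn0 hn x (x + k)
  obtain ⟨t, h3⟩ := hf.displacement_parallel h2 hs hnd hk0 hk x (x + n)
  have hind : B (f (x + k) - f x) (f (x + n) - f x) ≠ 0 :=
    hf.pairing_ne_zero h2 hs hnd hn0 hn (by simpa using hkn)
  have h4 : (1 - t) • (f (x + k) - f x) = (1 - s) • (f (x + n) - f x) := by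
    rw [sub_smul, sub_smul, ← h1, ← h3, add_right_comm]
    simp only [one_smul]
    abel
  have h5 := congrArg (fun v => B v (f (x + k) - f x)) h4
  simp only [map_smul, LinearMap.smul_apply, hf.null_displacement hk x, smul_eq_mul, mul_zero]
    at h5
  rw [hs] at h5
  have h6 : 1 - s = 0 := (mul_eq_zero.1 h5.symm).resolve_right hind
  rw [h1, ← sub_eq_zero.1 h6, one_smul]

theorem PreservesNull.sub_zero_add [FiniteDimensional F V] (hf : PreservesNull B f)
    (hdim : 3 ≤ Module.finrank F V) (h2 : (2 : F) ≠ 0) (hs : ∀ x y, B x y = B y x)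
    (hnd : ∀ x, (∀ y, B x y = 0) → x = 0) {m : V} (hm0 : m ≠ 0) (hm : B m m = 0) (x y : V) :
    f (x + y) - f 0 = (f x - f 0) + (f y - f 0) := by
  have h : ∀ x, f (x + y) - f x = f y - f 0 := by
    refine null_vector_induction hdim h2 hs hnd hm0 hm
      (p := fun y => ∀ x, f (x + y) - f x = f y - f 0) (by simp) ?_ ?_ y
    · intro y z hy hz x
      rw [← sub_add_sub_cancel _ (f (x + y)), ← add_assoc, hz, hy, ← hz y]
      abel
    · intro n hn hnm x
      have hn0 : n ≠ 0 := by rintro rfl; simp at hnm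
      have h3 := null_vector_induction hdim h2 hs hnd hn0 hn
        (p := fun y => ∀ x, f (x + y + n) - f (x + y) = f (x + n) - f x) (by simp)
        (fun y z hy hz x => by rw [← add_assoc, hz, hy])
        (fun k hk hkn => hf.displacement_add h2 hs hnd hn0 hn hk hkn) x 0
      simpa using h3
  rw [← h x]
  abel

end ConePreserving

section Semilinear

variable {F V : Type} [Field F]

theorem additive_eq_and_mul_of_sq (h2 : (2 : F) ≠ 0) {φ ψ : F → F}
    (hφ : ∀ a b, φ (a + b) = φ a + φ b) (hψ : ∀ a b, ψ (a + b) = ψ a + ψ b) (hφ1 : φ 1 = 1)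
    (hψ1 : ψ 1 = 1) (hφsq : ∀ c, φ (c * c) = φ c * ψ c) (hψsq : ∀ c, ψ (c * c) = φ c * ψ c) :
    ψ = φ ∧ ∀ a b, φ (a * b) = φ a * φ b := by
  have heq : ψ = φ := by
    funext a
    have h : ∀ c, φ (c + c) = ψ (c + c) := by
      intro c
      have h1 := (hφsq (c + 1)).trans (hψsq (c + 1)).symm
      have e : (c + 1) * (c + 1) = c * c + (c + c) + 1 := by ring
      rw [e, hφ, hφ, hψ, hψ (c * c), hφ1, hψ1, hφsq, hψsq] at h1
      linear_combination h1
    have e : a = a / 2 + a / 2 := by field_simp; ring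
    rw [e, h]
  subst heq
  refine ⟨rfl, fun a b => ?_⟩
  have h1 := hφsq (a + b)
  have e : (a + b) * (a + b) = a * a + (a * b + a * b) + b * b := by ring
  rw [e, hφ, hφ, hφ (a * b), hφsq, hφsq, hφ a b] at h1
  have h3 : 2 * (ψ (a * b) - ψ a * ψ b) = 0 := by linear_combination h1
  exact sub_eq_zero.1 ((mul_eq_zero.1 h3).resolve_left h2)

variable [AddCommGroup V] [Module F V] {B : LinearMap.BilinForm F V}

theorem scalar_action_on_hyperbolic_pair (h2 : (2 : F) ≠ 0) (hs : ∀ x y, B x y = B y x) {g : V ≃+ V}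
    (hnull : ∀ x, B (g x) (g x) = 0 ↔ B x x = 0)
    (hline : ∀ n, B n n = 0 → ∀ t : F, ∃ s : F, g (t • n) = s • g n)
    (horth : ∀ n, B n n = 0 → ∀ y, B (g y) (g n) = 0 ↔ B y n = 0)
    {m n w : V} (hm : B m m = 0) (hn : B n n = 0) (hmn : B m n ≠ 0) (hwm : B w m = 0)
    (hwn : B w n = 0) (hw : 2 * B m n + B w w = 0) {φ : F → F}
    (hφ : ∀ c, g (c • m) = φ c • g m) :
    (∀ c, g (c • n) = φ c • g n) ∧ φ 1 = 1 ∧ (∀ a b, φ (a + b) = φ a + φ b) ∧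
      ∀ a b, φ (a * b) = φ a * φ b := by
  choose ψ hψ using hline n hn
  have additive {k : V} (hk0 : k ≠ 0) {χ : F → F} (hχ : ∀ c, g (c • k) = χ c • g k) :
      χ 1 = 1 ∧ ∀ a b, χ (a + b) = χ a + χ b := by
    have hgk : g k ≠ 0 := by simpa using hk0
    refine ⟨smul_left_injective F hgk ?_, fun a b => smul_left_injective F hgk ?_⟩
    · simp [← hχ]
    · simp only [add_smul, ← hχ, map_add]
  obtain ⟨hφ1, hφadd⟩ := additive (by rintro rfl; simp at hmn) hφ
  obtain ⟨hψ1, hψadd⟩ := additive (by rintro rfl; simp at hmn) hψ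
  have hβ : B (g m) (g n) ≠ 0 := by rwa [Ne, horth n hn]
  have key (a b c : F) (habc : a * b = c * c) :
      2 * B (g m) (g n) * (φ a * ψ b) + B (g (c • w)) (g (c • w)) = 0 := by
    have h1 : B (g (a • m + b • n + c • w)) (g (a • m + b • n + c • w)) = 0 := by
      rw [hnull]
      simp only [map_add, map_smul, LinearMap.add_apply, LinearMap.smul_apply, smul_eq_mul, hn, hm,
        hwm, hwn, hs m w, hs n w, hs n m]
      linear_combination (2 * B m n) * habc + c * c * hw
    have h3 : B (g (c • w)) (g m) = 0 := (horth m hm _).2 (by simp [hwm])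
    have h4 : B (g (c • w)) (g n) = 0 := (horth n hn _).2 (by simp [hwn])
    have h5 : B (g m) (g m) = 0 := (hnull m).2 hm
    have h6 : B (g n) (g n) = 0 := (hnull n).2 hn
    rw [map_add g, map_add g, hφ, hψ] at h1
    simp only [map_add, map_smul, LinearMap.add_apply, LinearMap.smul_apply, smul_eq_mul, h3, h4,
      h5, h6, hs (g m) (g (c • w)), hs (g n) (g (c • w)), hs (g n) (g m)] at h1
    linear_combination h1
  have cancel {p q r : F} (hp : 2 * B (g m) (g n) * p + r = 0)
      (hq : 2 * B (g m) (g n) * q + r = 0) : p = q :=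
    mul_left_cancel₀ (mul_ne_zero h2 hβ) (by linear_combination hp - hq)
  obtain ⟨rfl, hmul⟩ := additive_eq_and_mul_of_sq h2 hφadd hψadd hφ1 hψ1
    (fun c => by simpa [hψ1] using cancel (key (c * c) 1 c (by ring)) (key c c c rfl))
    (fun c => by simpa [hφ1] using cancel (key 1 (c * c) c (by ring)) (key c c c rfl))
  exact ⟨hψ, hφ1, hφadd, hmul⟩

theorem exists_ringEquiv_semilinear [FiniteDimensional F V] (hdim : 3 ≤ Module.finrank F V)
    (h2 : (2 : F) ≠ 0) (hs : ∀ x y, B x y = B y x) (hnd : ∀ x, (∀ y, B x y = 0) → x = 0)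
    {g : V ≃+ V} (hnull : ∀ x, B (g x) (g x) = 0 ↔ B x x = 0)
    (hline : ∀ n, B n n = 0 → ∀ t : F, ∃ s : F, g (t • n) = s • g n)
    (hline' : ∀ n, B n n = 0 → ∀ s : F, ∃ t : F, g (t • n) = s • g n)
    (horth : ∀ n, B n n = 0 → ∀ y, B (g y) (g n) = 0 ↔ B y n = 0)
    {m : V} (hm0 : m ≠ 0) (hm : B m m = 0) :
    ∃ ρ : F ≃+* F, ∀ (c : F) (x : V), g (c • x) = ρ c • g x := by
  choose φ hφ using hline m hm
  have scaled (n : V) (hn : B n n = 0) (hnm : B n m ≠ 0) :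
      ∃ s : F, s ≠ 0 ∧ (∀ c, g (c • s • n) = φ c • g (s • n)) ∧ φ 1 = 1 ∧
        (∀ a b, φ (a + b) = φ a + φ b) ∧ ∀ a b, φ (a * b) = φ a * φ b := by
    obtain ⟨w, hwm, hwn, hw⟩ := exists_anisotropic_orthogonal hdim h2 hs hnd
      (m := m) (n := (B n m)⁻¹ • n) hm (by simp [hn]) (by simp [hs m n, hnm])
    have hwn' : B w n = 0 := by simpa [hnm] using hwn
    have hs0 : -(B w w) / (2 * B n m) ≠ 0 :=
      div_ne_zero (neg_ne_zero.2 hw) (mul_ne_zero h2 hnm)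
    refine ⟨_, hs0, scalar_action_on_hyperbolic_pair h2 hs hnull hline horth (w := w) hm
      (by simp [hn]) ?_ hwm (by simp [hwn']) ?_ hφ⟩
    · rw [map_smul, smul_eq_mul, hs m n]
      exact mul_ne_zero hs0 hnm
    · rw [map_smul, smul_eq_mul, hs m n]
      field_simp
      ring
  obtain ⟨n, hn, hnm⟩ := exists_null_pairing_eq_one h2 hs hnd hm0 hm
  obtain ⟨-, -, -, hφ1, hφadd, hφmul⟩ := scaled n hn (by simp [hnm])
  have hsemi (x : V) : ∀ c, g (c • x) = φ c • g x := by
    refine null_vector_induction hdim h2 hs hnd hm0 hm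
      (p := fun x => ∀ c, g (c • x) = φ c • g x) (by simp)
      (fun x y hx hy c => by rw [smul_add, map_add, hx, hy, map_add, smul_add]) ?_ x
    intro k hk hkm c
    obtain ⟨s, hs0, h, -⟩ := scaled k hk hkm
    have h1 := h (c * s⁻¹)
    have h3 := h s⁻¹
    rw [smul_smul, mul_assoc, inv_mul_cancel₀ hs0, mul_one, hφmul, mul_smul] at h1
    rw [smul_smul, inv_mul_cancel₀ hs0, one_smul] at h3
    rw [h1, h3]
  have hφ0 : φ 0 = 0 := by simpa using hφadd 0 0
  let Φ : F →+* F :=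
    { toFun := φ, map_one' := hφ1, map_mul' := hφmul, map_zero' := hφ0, map_add' := hφadd }
  have hbij : Function.Bijective Φ := by
    refine ⟨Φ.injective, fun s => ?_⟩
    obtain ⟨t, ht⟩ := hline' m hm s
    exact ⟨t, smul_left_injective F (by simpa using hm0 : g m ≠ 0) ((hφ t).symm.trans ht)⟩
  exact ⟨RingEquiv.ofBijective Φ hbij, fun c x => hsemi x c⟩

theorem exists_similarity_factor [FiniteDimensional F V] (hdim : 3 ≤ Module.finrank F V)
    (h2 : (2 : F) ≠ 0) (hs : ∀ x y, B x y = B y x) (hnd : ∀ x, (∀ y, B x y = 0) → x = 0)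
    {g : V ≃+ V} (horth : ∀ n, B n n = 0 → ∀ y, B (g y) (g n) = 0 ↔ B y n = 0)
    {ρ : F ≃+* F} (hρ : ∀ (c : F) (x : V), g (c • x) = ρ c • g x)
    {m : V} (hm0 : m ≠ 0) (hm : B m m = 0) :
    ∃ a : F, a ≠ 0 ∧ ∀ x y, B (g x) (g y) = a * ρ (B x y) := by
  have factor (k : V) (hk0 : k ≠ 0) (hk : B k k = 0) :
      ∃ a : F, a ≠ 0 ∧ ∀ y, B (g k) (g y) = a * ρ (B k y) := by
    obtain ⟨n, hn, hnk⟩ := exists_null_pairing_eq_one h2 hs hnd hk0 hk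
    refine ⟨B (g k) (g n), ?_, fun y => ?_⟩
    · rw [hs, Ne, horth k hk, hnk]
      exact one_ne_zero
    · have h : B (g (y - B k y • n)) (g k) = 0 := by
        rw [horth k hk]
        simp [hnk, hs y k]
      rw [hs, map_sub, hρ, map_sub, map_smul, smul_eq_mul] at h
      linear_combination h
  obtain ⟨a, ha, ham⟩ := factor m hm0 hm
  refine ⟨a, ha, fun x => null_vector_induction hdim h2 hs hnd hm0 hm
    (p := fun x => ∀ y, B (g x) (g y) = a * ρ (B x y)) (by simp)
    (fun x y hx hy z => by simp only [map_add, LinearMap.add_apply, hx, hy, mul_add]) ?_ x⟩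
  intro k hk hkm
  obtain ⟨b, -, hb⟩ := factor k (by rintro rfl; simp at hkm) hk
  have h : b * ρ (B k m) = a * ρ (B k m) := by rw [← hb, hs, ham, hs m k]
  rwa [mul_right_cancel₀ (by simpa using hkm) h] at hb

end Semilinear


/-- **Lester's theorem.** Let `F` be a field of characteristic
`≠ 2`, `V` a finite-dimensional `F`-vector space with `dim V ≥ 3`, and `B` a
nondegenerate symmetric bilinear form on `V` which is not anisotropic. If
`f : V → V` is a bijection preserving cones, i.e.
`f '' C(a) = C(f a)` where `C(a) = {x | B(x-a, x-a) = 0}`, then there exist a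
field automorphism `ρ` of `F`, a bijective `ρ`-semilinear map `L : V → V`, a
nonzero `a ∈ F`, and `b ∈ V` with `f(x) = L(x) + b` and
`B(L x, L y) = a · ρ(B(x,y))` for all `x, y`. -/
theorem lester_cone_preserving
    (F : Type) [Field F] (hchar : (2 : F) ≠ 0)
    (V : Type) [AddCommGroup V] [Module F V] [FiniteDimensional F V]
    (hdim : 3 ≤ Module.finrank F V)
    (B : LinearMap.BilinForm F V)
    (hsymm : ∀ x y : V, B x y = B y x)
    (hnondeg : B.Nondegenerate)
    (hisotropic : ∃ x : V, x ≠ 0 ∧ B x x = 0)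
    (f : V → V) (hf : Function.Bijective f)
    (hcones : ∀ a : V,
      f '' {x : V | B (x - a) (x - a) = 0} = {x : V | B (x - f a) (x - f a) = 0}) :
    ∃ (ρ : F ≃+* F) (L : V → V) (a : F) (b : V),
      Function.Bijective L ∧
      (∀ x y : V, L (x + y) = L x + L y) ∧
      (∀ (c : F) (x : V), L (c • x) = ρ c • L x) ∧
      a ≠ 0 ∧
      (∀ x : V, f x = L x + b) ∧
      (∀ x y : V, B (L x) (L y) = a * ρ (B x y)) := by
  have hnd : ∀ x, (∀ y, B x y = 0) → x = 0 := hnondeg.1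
  obtain ⟨m, hm0, hm⟩ := hisotropic
  let e : V ≃ V := Equiv.ofBijective f hf
  have he : PreservesNull B e := fun x y => by
    have h := hf.1.mem_set_image (a := x) (s := {x : V | B (x - y) (x - y) = 0})
    rwa [hcones] at h
  let g : V ≃+ V :=
    { e.trans (Equiv.subRight (f 0)) with
      map_add' := he.sub_zero_add hdim hchar hsymm hnd hm0 hm }
  have hg (x : V) : g x = e x - e 0 := rfl
  have hnull (x : V) : B (g x) (g x) = 0 ↔ B x x = 0 := by
    rw [hg, he, sub_zero]
  have hline (n : V) (hn : B n n = 0) (t : F) : ∃ s : F, g (t • n) = s • g n := by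
    by_cases hn0 : n = 0
    · simp [hn0]
    obtain ⟨s, h⟩ := he.exists_image_eq hchar hsymm hnd hn0 hn 0 t
    exact ⟨s, by simpa [hg, sub_eq_iff_eq_add'] using h⟩
  have hline' (n : V) (hn : B n n = 0) (s : F) : ∃ t : F, g (t • n) = s • g n := by
    by_cases hn0 : n = 0
    · simp [hn0]
    obtain ⟨t, h⟩ := he.exists_preimage_eq hchar hsymm hnd hn0 hn 0 s
    exact ⟨t, by simpa [hg, sub_eq_iff_eq_add'] using h⟩
  have horth (n : V) (hn : B n n = 0) (y : V) : B (g y) (g n) = 0 ↔ B y n = 0 := by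
    by_cases hn0 : n = 0
    · simp [hn0]
    simpa [hg] using he.pairing_eq_zero_iff hchar hsymm hnd hn0 hn 0 y
  obtain ⟨ρ, hρ⟩ :=
    exists_ringEquiv_semilinear hdim hchar hsymm hnd hnull hline hline' horth hm0 hm
  obtain ⟨a, ha, hB⟩ := exists_similarity_factor hdim hchar hsymm hnd horth hρ hm0 hm
  exact ⟨ρ, g, a, f 0, g.bijective, map_add g, hρ, ha, fun x => (sub_add_cancel (f x) (f 0)).symm,
    hB⟩
end
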